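/- Let d ≥ 1, t > 0, set c = ρ(d)·t where ρ(d) = π^{d/2}/Γ((d+2)/2), and let (λ_n) be a sequence of natural numbers with λ_n/n → ρ(d)t/2. For each n, let 𝒢(n,λ_n) be the random graph on n labelled vertices obtained by inserting λ_n edges drawn uniformly at random without replacement from the n(n−1)/2 possible edges. Then the degree distributions D_n of 𝒢(n,λ_n) satisfy a large deviation principle on 𝒫(ℕ), equipped with the weak topology, at speed n with good rate function η(δ) = H(δ ∥ q_c) if Σ_{r≥0} r·δ(r) = c, and η(δ) = ∞ otherwise. -/

import Mathlib

open MeasureTheory Filter Topology Finset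
open scoped ENNReal NNReal

/-- A rate function is good if all its sublevel sets (at finite levels) are compact. -/
def GoodRate {X : Type*} [TopologicalSpace X] (I : X → ℝ≥0∞) : Prop :=
  ∀ c : ℝ≥0, IsCompact {x | I x ≤ (c : ℝ≥0∞)}

/-- Large deviation principle at speed `n`, with good rate function `I`, for a sequence of
laws given as set functions `μ n : Set X → ℝ≥0∞` (the probability of each event):
compact sublevel sets, the upper bound on closed sets and the lower bound on open sets. -/
def IsLDP {X : Type*} [TopologicalSpace X] (μ : ℕ → Set X → ℝ≥0∞) (I : X → ℝ≥0∞) : Prop :=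
  GoodRate I ∧
  (∀ F : Set X, IsClosed F →
    limsup (fun n : ℕ => ((n : ℝ)⁻¹ : EReal) * ENNReal.log (μ n F)) atTop
      ≤ -(⨅ x ∈ F, (I x : EReal))) ∧
  (∀ O : Set X, IsOpen O →
    -(⨅ x ∈ O, (I x : EReal))
      ≤ liminf (fun n : ℕ => ((n : ℝ)⁻¹ : EReal) * ENNReal.log (μ n O)) atTop)

/-- The uniform probability distribution on a finite set (of graphs, configurations, …). -/
noncomputable def uniformOn {α : Type*} [MeasurableSpace α] (s : Finset α) : Measure α :=
  ((s.card : ℝ≥0∞))⁻¹ • ∑ x ∈ s, Measure.dirac x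

/-- Relative entropy `H(p ∥ q)` of measures on `ℕ`, with the conventions `0 log 0 = 0`
and `H(p ∥ q) = ∞` if `p ⋬ q`. -/
noncomputable def relEntN (p q : Measure ℕ) : ℝ≥0∞ := by
  classical
  exact if ∀ k : ℕ, q {k} = 0 → p {k} = 0 then
    (∑' k : ℕ, ENNReal.ofReal ((p {k}).toReal * Real.log ((p {k}).toReal / (q {k}).toReal)
      - (p {k}).toReal + (q {k}).toReal))
  else ⊤

/-- The Poisson distribution `q_c` with parameter `c`, as a measure on `ℕ`. -/
noncomputable def poisMeasure (c : ℝ) : Measure ℕ :=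
  Measure.sum fun k => ENNReal.ofReal (Real.exp (-c) * c ^ k / (Nat.factorial k)) •
    Measure.dirac k

/-- `ρ(d) = π^{d/2} / Γ((d+2)/2)`. -/
noncomputable def rho (d : ℕ) : ℝ := Real.pi ^ ((d : ℝ) / 2) / Real.Gamma (((d : ℝ) + 2) / 2)

/-- The rate function `η(δ) = H(δ ∥ q_c)` if `⟨δ⟩ = c`, and `η(δ) = ∞` otherwise. -/
noncomputable def etaRate (c : ℝ) (δ : ProbabilityMeasure ℕ) : ℝ≥0∞ := by
  classical
  exact if (∑' k : ℕ, (k : ℝ≥0∞) * (δ : Measure ℕ) {k}) = ENNReal.ofReal c then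
    relEntN (δ : Measure ℕ) (poisMeasure c)
  else ⊤

/-- The set of graphs on `n` labelled vertices (given by their edge sets, containing no
loops) with exactly `l` edges: the sample space of the Erdős–Rényi graph `𝒢(n, l)`. -/
noncomputable def erGraphs (n l : ℕ) : Finset (Finset (Sym2 (Fin n))) := by
  classical exact univ.filter fun E => (∀ e ∈ E, ¬ e.IsDiag) ∧ E.card = l

/-- The degree of vertex `v` in the graph with edge set `E`. -/
def degr {n : ℕ} (E : Finset (Sym2 (Fin n))) (v : Fin n) : ℕ := by
  classical exact (univ.filter fun u => s(u, v) ∈ E).card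

instance {n : ℕ} : MeasurableSpace (Finset (Sym2 (Fin n))) := ⊤


lemma tsum_fatou {f : ℕ → ℕ → ℝ≥0∞} {g : ℕ → ℝ≥0∞}
    (h : ∀ k, Tendsto (fun n => f n k) atTop (𝓝 (g k))) :
    ∑' k, g k ≤ liminf (fun n => ∑' k, f n k) atTop := by
  have := lintegral_liminf_le (μ := (Measure.count : Measure ℕ)) (f := f) (u := atTop)
    (fun i => measurable_of_countable _)
  simp only [lintegral_count] at this
  convert this using 2
  ext k
  exact (h k).liminf_eq.symm

lemma tendsto_of_mass {ν : ℕ → ProbabilityMeasure ℕ} {δ : ProbabilityMeasure ℕ}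
    (h : ∀ k, Tendsto (fun n => (ν n : Measure ℕ) {k}) atTop (𝓝 ((δ : Measure ℕ) {k}))) :
    Tendsto ν atTop (𝓝 δ) := by
  apply tendsto_of_forall_isOpen_le_liminf'
  intro G _
  have e : ∀ μ : Measure ℕ, μ G = ∑' x, G.indicator (fun x => μ {x}) x := fun μ =>
    (Measure.tsum_indicator_apply_singleton μ G (MeasurableSet.of_discrete)).symm
  simp only [e]
  apply tsum_fatou
  intro k
  by_cases hk : k ∈ G
  · simpa [Set.indicator, hk] using h k
  · simp [Set.indicator, hk]

lemma tsum_eq_of_tail {f : ℕ → ℕ → ℝ≥0∞} {g : ℕ → ℝ≥0∞} {S : ℝ≥0∞}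
    (h : ∀ k, Tendsto (fun n => f n k) atTop (𝓝 (g k)))
    (hS : Tendsto (fun n => ∑' k, f n k) atTop (𝓝 S))
    (ht : ∀ ε : ℝ≥0∞, 0 < ε → ∃ K, ∀ n, ∑' k, f n (k + K) ≤ ε) : ∑' k, g k = S := by
  apply le_antisymm
  · exact (tsum_fatou h).trans hS.liminf_eq.le
  · apply ENNReal.le_of_forall_pos_le_add
    intro ε hε _
    obtain ⟨K, hK⟩ := ht ε (by exact_mod_cast hε)
    have h1 : Tendsto (fun n => ∑ k ∈ range K, f n k + ε) atTop
        (𝓝 (∑ k ∈ range K, g k + ε)) :=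
      (tendsto_finsetSum _ (fun k _ => h k)).add tendsto_const_nhds
    have h2 := le_of_tendsto_of_tendsto' hS h1 (fun n => by
      rw [← Summable.sum_add_tsum_nat_add' (k := K) ENNReal.summable]
      gcongr
      exact hK n)
    exact h2.trans (by gcongr; exact ENNReal.sum_le_tsum _)

noncomputable def qc (c : ℝ) (k : ℕ) : ℝ := Real.exp (-c) * c ^ k / (Nat.factorial k)

lemma qc_pos {c : ℝ} (hc : 0 < c) (k : ℕ) : 0 < qc c k := by unfold qc; positivity

lemma pois_singleton (c : ℝ) (k : ℕ) : poisMeasure c {k} = ENNReal.ofReal (qc c k) := by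
  unfold poisMeasure qc
  rw [Measure.sum_apply _ (measurableSet_singleton k), tsum_eq_single k]
  · simp
  · intro b hb
    simp [hb]

lemma qc_hasSum (c : ℝ) : HasSum (qc c) 1 := by
  have := (NormedSpace.expSeries_div_hasSum_exp c).mul_left (Real.exp (-c))
  rw [← Real.exp_eq_exp_ℝ, ← Real.exp_add] at this
  simp at this
  have e : qc c = fun k => Real.exp (-c) * (c ^ k / (k.factorial : ℝ)) := by
    ext k; unfold qc; ring
  rw [e]; exact this

lemma qc_exp_summable (c θ : ℝ) : Summable (fun k : ℕ => qc c k * Real.exp (θ * k)) := by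
  have := (Real.summable_pow_div_factorial (c * Real.exp θ)).mul_left (Real.exp (-c))
  refine this.congr (fun k => ?_)
  unfold qc
  rw [mul_pow, ← Real.exp_nat_mul]
  ring_nf

/-- entropy summand -/
noncomputable def hh (q x : ℝ) : ℝ := x * Real.log (x / q) - x + q

lemma young {q x y : ℝ} (hq : 0 < q) (hx : 0 ≤ x) : x * y ≤ hh q x + q * Real.exp y - q := by
  unfold hh
  rcases hx.eq_or_lt with rfl | hx
  · simp; positivity
  · have h := Real.add_one_le_exp (y - Real.log (x / q))
    rw [Real.exp_sub, Real.exp_log (by positivity)] at h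
    have h2 := mul_le_mul_of_nonneg_left h hx.le
    have h3 : x * (Real.exp y / (x / q)) = q * Real.exp y := by field_simp
    rw [h3] at h2
    linarith

lemma hh_nonneg {q x : ℝ} (hq : 0 < q) (hx : 0 ≤ x) : 0 ≤ hh q x := by
  have := young (y := 0) hq hx
  simpa using this

lemma hh_cont {q : ℝ} (hq : 0 < q) : Continuous (hh q) := by
  have : hh q = fun x => x * Real.log x - x * Real.log q - x + q := by
    ext x
    unfold hh
    rcases eq_or_ne x 0 with rfl | hx
    · simp
    · rw [Real.log_div hx hq.ne']; ring
  rw [this]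
  have := Real.continuous_mul_log
  fun_prop

lemma relEnt_eq {c : ℝ} (hc : 0 < c) (p : Measure ℕ) :
    relEntN p (poisMeasure c) = ∑' k, ENNReal.ofReal (hh (qc c k) (p {k}).toReal) := by
  unfold relEntN
  rw [if_pos]
  · congr 1; ext k
    rw [pois_singleton, ENNReal.toReal_ofReal (qc_pos hc k).le]; rfl
  · intro k hk
    rw [pois_singleton] at hk
    have := qc_pos hc k
    simp at hk; linarith

lemma mass_ne_top (p : ProbabilityMeasure ℕ) (k : ℕ) : (p : Measure ℕ) {k} ≠ ⊤ := by simp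

lemma tail_bound {c : ℝ} (hc : 0 < c) (a : ℝ≥0) (ε : ℝ≥0∞) (hε : 0 < ε) :
    ∃ K, 1 ≤ K ∧ ∀ p : ProbabilityMeasure ℕ, relEntN (p : Measure ℕ) (poisMeasure c) ≤ a →
      ∑' k : ℕ, ((k + K : ℕ) : ℝ≥0∞) * (p : Measure ℕ) {k + K} ≤ ε := by
  wlog hfin : ε ≠ ⊤ generalizing ε
  · push Not at hfin
    subst hfin
    exact ⟨1, le_rfl, fun _ _ => le_top⟩
  set θ : ℝ := (a + 1) / ε.toReal with hθ
  have he : 0 < ε.toReal := ENNReal.toReal_pos hε.ne' hfin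
  have hθp : 0 < θ := by positivity
  have hs := qc_exp_summable c θ
  have htail := tendsto_sum_nat_add (fun k : ℕ => qc c k * Real.exp (θ * k))
  obtain ⟨K, hK1, hK⟩ := ((eventually_ge_atTop 1).and (htail.eventually_lt_const one_pos)).exists
  refine ⟨K, hK1, fun p hp => ?_⟩
  have hs' : Summable (fun k : ℕ => qc c (k + K) * Real.exp (θ * (k + K : ℕ))) :=
    (summable_nat_add_iff K).2 hs
  have h1 : ENNReal.ofReal θ * ∑' k : ℕ, ((k + K : ℕ) : ℝ≥0∞) * (p : Measure ℕ) {k + K} ≤ a + 1 := by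
    rw [← ENNReal.tsum_mul_left]
    calc _ ≤ ∑' k : ℕ, (ENNReal.ofReal (hh (qc c (k + K)) ((p : Measure ℕ) {k + K}).toReal) +
          ENNReal.ofReal (qc c (k + K) * Real.exp (θ * (k + K : ℕ)))) := by
          apply ENNReal.tsum_le_tsum
          intro k
          have hq := qc_pos hc (k + K)
          have hn := hh_nonneg hq (x := ((p : Measure ℕ) {k + K}).toReal) ENNReal.toReal_nonneg
          rw [← ENNReal.ofReal_add hn (by positivity)]
          have : ((k + K : ℕ) : ℝ≥0∞) * (p : Measure ℕ) {k + K}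
              = ENNReal.ofReal ((k + K : ℕ) * ((p : Measure ℕ) {k + K}).toReal) := by
            rw [ENNReal.ofReal_mul (by positivity), ENNReal.ofReal_natCast,
              ENNReal.ofReal_toReal (mass_ne_top _ _)]
          rw [this, ← ENNReal.ofReal_mul hθp.le]
          apply ENNReal.ofReal_le_ofReal
          have := young (y := θ * (k + K : ℕ)) hq (x := ((p : Measure ℕ) {k + K}).toReal)
            ENNReal.toReal_nonneg
          nlinarith
      _ ≤ a + 1 := by
          rw [ENNReal.tsum_add]
          gcongr
          · rw [relEnt_eq hc] at hp
            refine le_trans ?_ hp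
            have e := Summable.sum_add_tsum_nat_add' (k := K) (f := fun k =>
              ENNReal.ofReal (hh (qc c k) ((p : Measure ℕ) {k}).toReal)) ENNReal.summable
            rw [← e]
            exact le_add_left le_rfl
          · rw [← ENNReal.ofReal_tsum_of_nonneg (fun k => by have := qc_pos hc (k+K); positivity) hs']
            rw [← ENNReal.ofReal_one]
            exact ENNReal.ofReal_le_ofReal hK.le
  have h2 : ((a : ℝ≥0∞) + 1) = ENNReal.ofReal θ * ε := by
    rw [hθ]
    nth_rewrite 2 [← ENNReal.ofReal_toReal hfin]
    rw [← ENNReal.ofReal_mul (by positivity), div_mul_cancel₀ _ he.ne',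
      ENNReal.ofReal_add (by positivity) (by positivity)]
    simp
  rw [h2] at h1
  exact (ENNReal.mul_le_mul_iff_right (by simpa using hθp) ENNReal.ofReal_ne_top).1 h1

noncomputable def mkPM (P : ℕ → ℝ≥0∞) (h : ∑' k, P k = 1) : ProbabilityMeasure ℕ :=
  ⟨Measure.sum fun k => P k • Measure.dirac k, ⟨by
    rw [Measure.sum_apply _ MeasurableSet.univ]; simpa using h⟩⟩

lemma mkPM_mass (P : ℕ → ℝ≥0∞) (h : ∑' k, P k = 1) (k : ℕ) : (mkPM P h : Measure ℕ) {k} = P k := by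
  change (Measure.sum fun k => P k • Measure.dirac k) {k} = P k
  rw [Measure.sum_apply _ (measurableSet_singleton k), tsum_eq_single k]
  · simp
  · intro b hb
    simp [hb]

lemma pm_tsum (p : ProbabilityMeasure ℕ) : ∑' k, (p : Measure ℕ) {k} = 1 := by
  have := Measure.tsum_indicator_apply_singleton (p : Measure ℕ) Set.univ MeasurableSet.univ
  simpa using this

lemma key_compact {c : ℝ} (hc : 0 < c) (a : ℝ≥0) (ν : ℕ → ProbabilityMeasure ℕ)
    (hν : ∀ n, relEntN (ν n : Measure ℕ) (poisMeasure c) ≤ a)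
    (hm : Tendsto (fun n => ∑' k : ℕ, (k : ℝ≥0∞) * (ν n : Measure ℕ) {k}) atTop
      (𝓝 (ENNReal.ofReal c))) :
    ∃ (δ : ProbabilityMeasure ℕ) (φ : ℕ → ℕ), StrictMono φ ∧ Tendsto (ν ∘ φ) atTop (𝓝 δ) ∧
      etaRate c δ ≤ a := by
  obtain ⟨P, φ, hφ, hP⟩ := CompactSpace.tendsto_subseq (fun n (k : ℕ) => (ν n : Measure ℕ) {k})
  rw [tendsto_pi_nhds] at hP
  have hP' : ∀ k, Tendsto (fun n => (ν (φ n) : Measure ℕ) {k}) atTop (𝓝 (P k)) := hP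
  have hle : ∀ k, P k ≤ 1 := fun k => le_of_tendsto' (hP' k) (fun n => prob_le_one)
  have hfin : ∀ k, P k ≠ ⊤ := fun k => ((hle k).trans_lt ENNReal.one_lt_top).ne
  have hsum : ∑' k, P k = 1 := by
    apply tsum_eq_of_tail hP'
    · simp only [pm_tsum]; exact tendsto_const_nhds
    · intro ε hε
      obtain ⟨K, hK1, hK⟩ := tail_bound hc a ε hε
      refine ⟨K, fun n => le_trans (ENNReal.tsum_le_tsum fun k => ?_) (hK (ν (φ n)) (hν _))⟩
      refine le_mul_of_one_le_left (zero_le) ?_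
      exact_mod_cast (by omega : 1 ≤ k + K)
  have hmean : ∑' k : ℕ, (k : ℝ≥0∞) * P k = ENNReal.ofReal c := by
    apply tsum_eq_of_tail (f := fun n k => (k : ℝ≥0∞) * (ν (φ n) : Measure ℕ) {k})
    · intro k
      exact ENNReal.Tendsto.const_mul (hP' k) (Or.inr (by simp))
    · exact hm.comp hφ.tendsto_atTop
    · intro ε hε
      obtain ⟨K, hK1, hK⟩ := tail_bound hc a ε hε
      exact ⟨K, fun n => hK _ (hν _)⟩
  refine ⟨mkPM P hsum, φ, hφ, tendsto_of_mass (fun k => ?_), ?_⟩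
  · rw [mkPM_mass]; exact hP' k
  · unfold etaRate
    simp only [mkPM_mass]
    rw [if_pos hmean, relEnt_eq hc]
    simp only [mkPM_mass]
    refine (tsum_fatou (f := fun n k => ENNReal.ofReal
      (hh (qc c k) ((ν (φ n) : Measure ℕ) {k}).toReal)) (fun k => ?_)).trans ?_
    · apply ENNReal.tendsto_ofReal
      exact ((hh_cont (qc_pos hc k)).tendsto _).comp ((ENNReal.tendsto_toReal (hfin k)).comp (hP' k))
    · refine liminf_le_of_le (by isBoundedDefault) (fun b hb => ?_)
      obtain ⟨n, hn⟩ := hb.exists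
      refine hn.trans ?_
      rw [← relEnt_eq hc]
      exact hν _

lemma eta_le_iff {c : ℝ} {δ : ProbabilityMeasure ℕ} {a : ℝ≥0∞} (ha : a ≠ ⊤) (h : etaRate c δ ≤ a) :
    (∑' k : ℕ, (k : ℝ≥0∞) * (δ : Measure ℕ) {k}) = ENNReal.ofReal c ∧
      relEntN (δ : Measure ℕ) (poisMeasure c) ≤ a := by
  unfold etaRate at h
  split_ifs at h with h1
  · exact ⟨h1, h⟩
  · exact absurd (top_le_iff.1 h) ha

lemma eta_good {c : ℝ} (hc : 0 < c) : GoodRate (etaRate c) := by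
  intro a
  apply IsSeqCompact.isCompact
  intro ν hν
  have h := fun n => eta_le_iff ENNReal.coe_ne_top (hν n)
  obtain ⟨δ, φ, h1, h2, h3⟩ := key_compact hc a ν (fun n => (h n).2)
    (by simp only [(h _).1]; exact tendsto_const_nhds)
  exact ⟨δ, h3, φ, h1, h2⟩

/-- finite-coordinate neighbourhoods -/
lemma nbhd_basic {O : Set (ProbabilityMeasure ℕ)} (hO : IsOpen O) {δ : ProbabilityMeasure ℕ}
    (hδ : δ ∈ O) : ∃ (K : ℕ) (ε : ℝ), 0 < ε ∧ ∀ ν : ProbabilityMeasure ℕ,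
      (∀ k < K, |((ν : Measure ℕ) {k}).toReal - ((δ : Measure ℕ) {k}).toReal| < ε) → ν ∈ O := by
  by_contra hcon
  push Not at hcon
  have := fun j : ℕ => hcon j (1 / ((j : ℝ) + 1)) (by positivity)
  choose ν h1 h2 using this
  have : Tendsto ν atTop (𝓝 δ) := by
    apply tendsto_of_mass
    intro k
    rw [← ENNReal.tendsto_toReal_iff (fun n => mass_ne_top _ _) (mass_ne_top _ _)]
    rw [tendsto_iff_dist_tendsto_zero]
    refine squeeze_zero' (Eventually.of_forall fun _ => dist_nonneg) ?_
      tendsto_one_div_add_atTop_nhds_zero_nat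
    filter_upwards [eventually_gt_atTop k] with n hn
    exact (h1 n k hn).le
  obtain ⟨n, hn⟩ := (this.eventually (hO.mem_nhds hδ)).exists
  exact h2 n hn

/-- eventual lower bound of the entropy on a closed set -/
lemma ent_lower {c : ℝ} (hc : 0 < c) {F : Set (ProbabilityMeasure ℕ)} (hF : IsClosed F) (a : ℝ≥0)
    (ha : ∀ x ∈ F, (a : ℝ≥0∞) < etaRate c x) (s : ℕ → ℝ) (hs : Tendsto s atTop (𝓝 c)) :
    ∀ᶠ n in atTop, ∀ ν ∈ F, (∑' k : ℕ, (k : ℝ≥0∞) * ((ν : ProbabilityMeasure ℕ) : Measure ℕ) {k})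
      = ENNReal.ofReal (s n) → (a : ℝ≥0∞) ≤ relEntN (ν : Measure ℕ) (poisMeasure c) := by
  by_contra hcon
  rw [not_eventually] at hcon
  obtain ⟨ψ, hψ, h⟩ := extraction_of_frequently_atTop hcon
  push Not at h
  choose ν h1 h2 h3 using h
  obtain ⟨δ, φ, g1, g2, g3⟩ := key_compact hc a ν (fun n => (h3 n).le) (by
    simp only [h2]
    exact (ENNReal.tendsto_ofReal hs).comp hψ.tendsto_atTop)
  have : δ ∈ F := hF.mem_of_tendsto g2 (Eventually.of_forall fun n => h1 _)
  exact absurd (ha δ this) (not_lt.2 g3)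


/-- averaging operator: throw one ball in a uniform bin -/
noncomputable def TT {n : ℕ} (f : (Fin n → ℕ) → ℝ) (d : Fin n → ℕ) : ℝ :=
  (n : ℝ)⁻¹ * ∑ v : Fin n, f (d + Pi.single v 1)

/-- ℓ¹ distance of occupation vectors -/
def rh {n : ℕ} (d e : Fin n → ℕ) : ℕ := ∑ v, ((d v : ℤ) - e v).natAbs

lemma rh_self {n : ℕ} (d : Fin n → ℕ) : rh d d = 0 := by simp [rh]

lemma rh_comm {n : ℕ} (d e : Fin n → ℕ) : rh d e = rh e d := by
  unfold rh
  exact sum_congr rfl (fun v _ => by omega)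

lemma rh_tri {n : ℕ} (d e f : Fin n → ℕ) : rh d f ≤ rh d e + rh e f := by
  unfold rh
  rw [← sum_add_distrib]
  exact sum_le_sum (fun v _ => by omega)

lemma rh_single {n : ℕ} (d : Fin n → ℕ) (v : Fin n) : rh d (d + Pi.single v 1) = 1 := by
  unfold rh
  rw [sum_eq_single v]
  · simp
  · intro b _ hb; simp [hb]
  · simp

lemma rh_add {n : ℕ} (d e x : Fin n → ℕ) : rh (d + x) (e + x) = rh d e := by
  unfold rh
  exact sum_congr rfl (fun v _ => by simp)

lemma TT_mono {n : ℕ} {f g : (Fin n → ℕ) → ℝ} (h : ∀ d, f d ≤ g d) (d) : TT f d ≤ TT g d := by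
  unfold TT
  gcongr
  exact h _

lemma TT_iter_mono {n : ℕ} {f g : (Fin n → ℕ) → ℝ} (h : ∀ d, f d ≤ g d) (N : ℕ) (d) :
    TT^[N] f d ≤ TT^[N] g d := by
  induction N generalizing f g with
  | zero => exact h d
  | succ N ih => exact ih (TT_mono h)

lemma TT_iter_le {n : ℕ} (hn : 0 < n) {f : (Fin n → ℕ) → ℝ} (j : ℕ) (d) (a : ℝ)
    (h : ∀ e, rh d e ≤ j → f e ≤ a) : TT^[j] f d ≤ a := by
  induction j generalizing d with
  | zero => exact h d (by simp [rh_self])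
  | succ j ih =>
    rw [Function.iterate_succ_apply']
    rw [TT]
    have : ∀ v ∈ (univ : Finset (Fin n)), TT^[j] f (d + Pi.single v 1) ≤ a := fun v _ =>
      ih _ (fun e he => h e (by
        have := rh_single d v
        have := rh_tri d (d + Pi.single v 1) e
        omega))
    have h2 := sum_le_card_nsmul _ _ _ this
    have hn' : (0 : ℝ) < n := by exact_mod_cast hn
    rw [inv_mul_le_iff₀ hn']
    simpa using h2

lemma le_TT_iter {n : ℕ} (hn : 0 < n) {f : (Fin n → ℕ) → ℝ} (j : ℕ) (d) (a : ℝ)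
    (h : ∀ e, rh d e ≤ j → a ≤ f e) : a ≤ TT^[j] f d := by
  induction j generalizing d with
  | zero => exact h d (by simp [rh_self])
  | succ j ih =>
    rw [Function.iterate_succ_apply']
    rw [TT]
    have : ∀ v ∈ (univ : Finset (Fin n)), a ≤ TT^[j] f (d + Pi.single v 1) := fun v _ =>
      ih _ (fun e he => h e (by
        have := rh_single d v
        have := rh_tri d (d + Pi.single v 1) e
        omega))
    have h2 := card_nsmul_le_sum _ _ _ this
    have hn' : (0 : ℝ) < n := by exact_mod_cast hn
    rw [le_inv_mul_iff₀ hn']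
    simpa using h2

open Classical in
/-- real indicator -/
noncomputable def ind {α : Type*} (U : Set α) (x : α) : ℝ := if x ∈ U then 1 else 0

lemma ind_nonneg {α : Type*} (U : Set α) (x : α) : 0 ≤ ind U x := by
  unfold ind; split_ifs <;> norm_num

lemma ind_le_one {α : Type*} (U : Set α) (x : α) : ind U x ≤ 1 := by
  unfold ind; split_ifs <;> norm_num

lemma ind_le {α β : Type*} {U : Set α} {V : Set β} {x : α} {y : β} (h : x ∈ U → y ∈ V) :
    ind U x ≤ ind V y := by
  unfold ind
  by_cases hx : x ∈ U
  · simp [hx, h hx]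
  · simp only [hx, if_false]; split_ifs <;> norm_num

lemma TT_shift {n : ℕ} (hn : 0 < n) {U U' : Set (Fin n → ℕ)} {r M N : ℕ}
    (hU : ∀ d e, d ∈ U → rh d e ≤ r → e ∈ U') (h1 : M ≤ N + r) (h2 : N ≤ M + r) :
    TT^[M] (ind U) 0 ≤ TT^[N] (ind U') 0 := by
  rcases le_total N M with h | h
  · obtain ⟨j, rfl⟩ := Nat.exists_eq_add_of_le h
    rw [Function.iterate_add_apply]
    apply TT_iter_mono
    intro d
    apply TT_iter_le hn
    intro e he
    exact ind_le (fun h => hU e d h (by rw [rh_comm]; omega))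
  · obtain ⟨j, rfl⟩ := Nat.exists_eq_add_of_le h
    rw [Function.iterate_add_apply]
    apply TT_iter_mono
    intro d
    apply le_TT_iter hn
    intro e he
    exact ind_le (fun h => hU d e h (by omega))

/-- exponential sum over occupation vectors -/
noncomputable def SS {n : ℕ} (N : ℕ) (f : (Fin n → ℕ) → ℝ) : ℝ :=
  ∑ d ∈ piAntidiag (univ : Finset (Fin n)) N, f d / ∏ v, ((d v).factorial : ℝ)

lemma SS_step_aux {n : ℕ} (N : ℕ) (f : (Fin n → ℕ) → ℝ) (v : Fin n) :
    ∑ d ∈ piAntidiag (univ : Finset (Fin n)) (N + 1),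
      (d v : ℝ) * (f d / ∏ v, ((d v).factorial : ℝ)) =
    ∑ d ∈ piAntidiag (univ : Finset (Fin n)) N,
      f (d + Pi.single v 1) / ∏ v, ((d v).factorial : ℝ) := by
  rw [← sum_filter_of_ne (p := fun d : Fin n → ℕ => d v ≠ 0)]
  swap
  · intro d _ h h0
    simp [h0] at h
  symm
  refine sum_bij' (fun d _ => d + Pi.single v 1) (fun d _ => d - Pi.single v 1) ?_ ?_ ?_ ?_ ?_
  · intro d hd
    simp only [mem_piAntidiag, mem_filter] at hd ⊢
    refine ⟨⟨?_, by simp⟩, by simp⟩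
    simp [sum_add_distrib, hd.1]
  · intro d hd
    simp only [mem_piAntidiag, mem_filter] at hd ⊢
    refine ⟨?_, by simp⟩
    have hd' : d = (d - Pi.single v 1) + Pi.single v 1 := by
      ext w
      by_cases hw : w = v
      · subst hw; have := hd.2; simp; omega
      · simp [hw]
    have h2 := hd.1.1
    rw [hd'] at h2
    simp only [Pi.add_apply, sum_add_distrib, Finset.sum_pi_single', mem_univ, if_true] at h2
    simpa using h2
  · intro d _
    ext w; simp
  · intro d hd
    simp only [mem_piAntidiag, mem_filter] at hd
    ext w
    by_cases hw : w = v
    · subst hw; have := hd.2; simp; omega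
    · simp [hw]
  · intro d _
    have e : ∏ w, (((d + Pi.single v 1 : Fin n → ℕ) w).factorial : ℝ)
        = (d v + 1) * ∏ w, ((d w).factorial : ℝ) := by
      rw [← mul_prod_erase _ _ (mem_univ v), ← mul_prod_erase (a := v) univ
        (fun w => ((d w).factorial : ℝ)) (mem_univ v), ← mul_assoc]
      congr 1
      · simp [Nat.factorial_succ]
      · apply prod_congr rfl
        intro w hw
        simp [ne_of_mem_erase hw]
    rw [e]
    have : (0 : ℝ) < ∏ w, ((d w).factorial : ℝ) := prod_pos (fun w _ => by positivity)
    simp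
    field_simp

lemma SS_step {n : ℕ} (hn : 0 < n) (N : ℕ) (f : (Fin n → ℕ) → ℝ) :
    (N + 1) * SS (N + 1) f = n * SS N (TT f) := by
  have hn' : (n : ℝ) ≠ 0 := by positivity
  have h1 : (N + 1) * SS (N + 1) f = ∑ v : Fin n, ∑ d ∈ piAntidiag (univ : Finset (Fin n)) (N + 1),
      (d v : ℝ) * (f d / ∏ v, ((d v).factorial : ℝ)) := by
    rw [sum_comm]
    unfold SS
    rw [mul_sum]
    apply sum_congr rfl
    intro d hd
    rw [← sum_mul]
    congr 1
    simp only [mem_piAntidiag] at hd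
    exact_mod_cast hd.1.symm
  rw [h1]
  simp only [SS_step_aux]
  rw [sum_comm]
  unfold SS TT
  rw [mul_sum]
  apply sum_congr rfl
  intro d _
  rw [← sum_div]
  field_simp

lemma TT_formula {n : ℕ} (hn : 0 < n) (N : ℕ) (f : (Fin n → ℕ) → ℝ) :
    (N.factorial : ℝ) * SS N f = (n : ℝ) ^ N * TT^[N] f 0 := by
  induction N generalizing f with
  | zero => simp [SS]
  | succ N ih =>
    rw [Function.iterate_succ_apply, pow_succ, mul_right_comm, ← ih, Nat.factorial_succ]
    push_cast
    have := SS_step hn N f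
    linear_combination (N.factorial : ℝ) * this

/-- Poisson weight of a vector -/
lemma prod_qc {n : ℕ} (c : ℝ) (N : ℕ) (d : Fin n → ℕ) (hd : ∑ v, d v = N) :
    ∏ v, qc c (d v) = Real.exp (-c) ^ n * c ^ N / ∏ v, ((d v).factorial : ℝ) := by
  unfold qc
  rw [prod_div_distrib, prod_mul_distrib, prod_pow_eq_pow_sum, hd]
  simp

lemma pois_TT {n : ℕ} (hn : 0 < n) {c : ℝ} (N : ℕ) (f : (Fin n → ℕ) → ℝ) :
    ∑ d ∈ piAntidiag (univ : Finset (Fin n)) N, f d * ∏ v, qc c (d v)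
      = qc (c * n) N * TT^[N] f 0 := by
  have h := TT_formula hn N f
  have h1 : ∑ d ∈ piAntidiag (univ : Finset (Fin n)) N, f d * ∏ v, qc c (d v)
      = Real.exp (-c) ^ n * c ^ N * SS N f := by
    unfold SS
    rw [mul_sum]
    apply sum_congr rfl
    intro d hd
    simp only [mem_piAntidiag] at hd
    rw [prod_qc c N d hd.1]
    ring
  rw [h1]
  have h2 : SS N f = (n : ℝ) ^ N * TT^[N] f 0 / N.factorial := by
    rw [← h]; field_simp
  rw [h2]
  unfold qc
  rw [← Real.exp_nat_mul, mul_pow]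
  ring_nf


/-- non-loop edges -/
def ND (n : ℕ) : Finset (Sym2 (Fin n)) := univ.filter fun e => ¬ e.IsDiag

lemma erGraphs_eq (n l : ℕ) : erGraphs n l = powersetCard l (ND n) := by
  ext E
  simp [erGraphs, ND, mem_powersetCard, subset_iff]

lemma degr_insert {n : ℕ} (E : Finset (Sym2 (Fin n))) (u v : Fin n) (huv : u ≠ v)
    (h : s(u, v) ∉ E) : degr (insert s(u, v) E) = degr E + Pi.single u 1 + Pi.single v 1 := by
  classical
  ext y
  have e1 : degr (insert s(u, v) E) y = (univ.filter fun x => s(x, y) ∈ insert s(u, v) E).card := by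
    unfold degr; congr
  have e2 : degr E y = (univ.filter fun x => s(x, y) ∈ E).card := by
    unfold degr; congr
  rw [Pi.add_apply, Pi.add_apply, e1, e2]
  have e3 : (univ.filter fun x => s(x, y) ∈ insert s(u, v) E)
      = (univ.filter fun x => s(x, y) = s(u, v)) ∪ (univ.filter fun x => s(x, y) ∈ E) := by
    ext x; simp
  rw [e3, card_union_of_disjoint]
  swap
  · rw [disjoint_left]
    intro x hx hx'
    simp only [mem_filter, mem_univ, true_and] at hx hx'
    exact h (hx ▸ hx')
  by_cases h1 : y = u
  · subst h1
    have : (univ.filter fun x => s(x, y) = s(y, v)) = {v} := by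
      ext x; simp [Sym2.eq_iff, huv]
    rw [this]
    simp [huv]; omega
  · by_cases h2 : y = v
    · subst h2
      have : (univ.filter fun x => s(x, y) = s(u, y)) = {u} := by
        ext x; simp [Sym2.eq_iff, h1]
      rw [this]
      simp [h1]; omega
    · have : (univ.filter fun x => s(x, y) = s(u, v)) = ∅ := by
        ext x; simp [Sym2.eq_iff, h1, h2]
      rw [this]
      simp [h1, h2]

lemma sum_pairs {n : ℕ} (S : Finset (Sym2 (Fin n))) (hS : S ⊆ ND n) (ψ : Sym2 (Fin n) → ℝ) :
    ∑ p : Fin n × Fin n, (if s(p.1, p.2) ∈ S then ψ s(p.1, p.2) else 0) = 2 * ∑ e ∈ S, ψ e := by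
  classical
  rw [← sum_filter, mul_sum]
  rw [← sum_fiberwise_of_maps_to (s := univ.filter fun p : Fin n × Fin n => s(p.1, p.2) ∈ S)
    (t := S) (g := fun p => s(p.1, p.2))]
  swap
  · intro p hp; simpa using hp
  apply sum_congr rfl
  intro e he
  induction e with
  | _ a b =>
  have hab : a ≠ b := by
    have := hS he
    simpa [ND] using this
  have : ({p ∈ univ.filter fun p : Fin n × Fin n => s(p.1, p.2) ∈ S | s(p.1, p.2) = s(a, b)})
      = {(a, b), (b, a)} := by
    ext ⟨x, y⟩
    simp only [mem_filter, mem_univ, true_and, mem_insert, mem_singleton, Prod.mk.injEq]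
    rw [Sym2.eq_iff]
    constructor
    · rintro ⟨_, h⟩; exact h
    · rintro (⟨rfl, rfl⟩ | ⟨rfl, rfl⟩)
      · exact ⟨he, by simp⟩
      · exact ⟨by rw [Sym2.eq_swap]; exact he, by simp⟩
  rw [this, sum_pair (by simp [hab])]
  rw [Sym2.eq_swap (a := b)]
  ring

lemma card_ND (n : ℕ) : 2 * ((ND n).card : ℝ) = (n : ℝ) ^ 2 - n := by
  have h := sum_pairs (ND n) (Subset.refl _) (fun _ => 1)
  simp only [sum_const, nsmul_eq_mul, mul_one] at h
  rw [← h, Fintype.sum_prod_type]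
  have : ∀ x y : Fin n, (if s(x, y) ∈ ND n then (1 : ℝ) else 0) = 1 - if x = y then 1 else 0 := by
    intro x y
    by_cases hxy : x = y <;> simp [ND, hxy]
  simp only [this]
  simp [sum_sub_distrib]
  ring

lemma double_count {n : ℕ} (k : ℕ) (g : Finset (Sym2 (Fin n)) → ℝ) :
    ((k : ℝ) + 1) * ∑ E ∈ erGraphs n (k + 1), g E
      = ∑ E ∈ erGraphs n k, ∑ e ∈ ND n \ E, g (insert e E) := by
  have h1 : ((k : ℝ) + 1) * ∑ E ∈ erGraphs n (k + 1), g E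
      = ∑ E ∈ erGraphs n (k + 1), ∑ e ∈ E, g E := by
    rw [mul_sum]
    apply sum_congr rfl
    intro E hE
    rw [erGraphs_eq, mem_powersetCard] at hE
    rw [sum_const, hE.2]; simp
  rw [h1, sum_sigma', sum_sigma']
  refine sum_bij' (fun x _ => ⟨x.1.erase x.2, x.2⟩) (fun x _ => ⟨insert x.2 x.1, x.2⟩) ?_ ?_ ?_ ?_ ?_
  · rintro ⟨E, e⟩ h
    simp only [mem_sigma, erGraphs_eq, mem_powersetCard, Finset.mem_sdiff] at h ⊢
    refine ⟨⟨(erase_subset _ _).trans h.1.1, ?_⟩, h.1.1 h.2, by simp⟩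
    rw [card_erase_of_mem h.2]; omega
  · rintro ⟨E, e⟩ h
    simp only [mem_sigma, erGraphs_eq, mem_powersetCard, Finset.mem_sdiff] at h ⊢
    refine ⟨⟨insert_subset h.2.1 h.1.1, ?_⟩, by simp⟩
    rw [card_insert_of_notMem h.2.2]; omega
  · rintro ⟨E, e⟩ h
    simp only [mem_sigma] at h
    simp [insert_erase h.2]
  · rintro ⟨E, e⟩ h
    simp only [mem_sigma, Finset.mem_sdiff] at h
    simp [erase_insert h.2.2]
  · rintro ⟨E, e⟩ h
    simp only [mem_sigma] at h
    simp [insert_erase h.2]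

lemma TT_two {n : ℕ} (f : (Fin n → ℕ) → ℝ) (d : Fin n → ℕ) :
    TT (TT f) d = ((n : ℝ) ^ 2)⁻¹ * ∑ p : Fin n × Fin n, f (d + Pi.single p.1 1 + Pi.single p.2 1) := by
  unfold TT
  rw [Fintype.sum_prod_type, ← mul_sum, ← mul_assoc]
  congr 1
  rw [sq, mul_inv]

lemma graph_upper {n : ℕ} (hn : 0 < n) (k : ℕ) (f : (Fin n → ℕ) → ℝ) (hf : ∀ d, 0 ≤ f d) :
    (2 : ℝ) ^ k * (k.factorial : ℝ) * ∑ E ∈ erGraphs n k, f (degr E) ≤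
      ((n : ℝ) ^ 2) ^ k * TT^[2 * k] f 0 := by
  have hn' : (0 : ℝ) < n := by exact_mod_cast hn
  induction k generalizing f with
  | zero =>
    have : degr (∅ : Finset (Sym2 (Fin n))) = 0 := by ext v; simp [degr]
    simp [erGraphs_eq, this]
  | succ k ih =>
    have hT : ∀ d, 0 ≤ TT (TT f) d := fun d => by
      rw [TT_two]
      exact mul_nonneg (by positivity) (sum_nonneg fun _ _ => hf _)
    have h := ih (TT (TT f)) hT
    rw [show 2 * (k + 1) = 2 * k + 1 + 1 by ring, Function.iterate_succ_apply,
      Function.iterate_succ_apply]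
    have h0 := mul_le_mul_of_nonneg_right h (by positivity : (0 : ℝ) ≤ (n : ℝ) ^ 2)
    have h00 : ((n : ℝ) ^ 2) ^ (k + 1) * TT^[2 * k] (TT (TT f)) 0 =
      ((n : ℝ) ^ 2) ^ k * TT^[2 * k] (TT (TT f)) 0 * (n : ℝ) ^ 2 := by ring
    rw [h00]
    refine le_trans ?_ h0
    have hdc := double_count k (fun E : Finset (Sym2 (Fin n)) => f (degr E))
    rw [pow_succ, Nat.factorial_succ]
    push_cast
    have h3 : 2 * (((k : ℝ) + 1) * ∑ E ∈ erGraphs n (k + 1), f (degr E)) ≤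
        (n : ℝ) ^ 2 * ∑ E ∈ erGraphs n k, TT (TT f) (degr E) := by
      rw [hdc, mul_sum, mul_sum]
      apply sum_le_sum
      intro E _
      rw [← sum_pairs (ND n \ E) sdiff_subset, TT_two, ← mul_assoc, mul_inv_cancel₀ (by positivity),
        one_mul]
      apply sum_le_sum
      intro p _
      split_ifs with hp
      · simp only [Finset.mem_sdiff, ND, mem_filter, mem_univ, true_and, Sym2.mk_isDiag_iff] at hp
        rw [degr_insert _ _ _ hp.1 hp.2]
      · exact hf _
    have h4 : (0 : ℝ) ≤ 2 ^ k * k.factorial := by positivity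
    nlinarith [mul_le_mul_of_nonneg_left h3 h4]

/-- one step of the coupling -/
noncomputable def KK {n : ℕ} (f : (Fin n → ℕ) → Finset (Sym2 (Fin n)) → ℝ)
    (d : Fin n → ℕ) (E : Finset (Sym2 (Fin n))) : ℝ :=
  ((n : ℝ) ^ 2)⁻¹ * ∑ p : Fin n × Fin n,
    if s(p.1, p.2) ∈ ND n \ E then
      f (d + Pi.single p.1 1 + Pi.single p.2 1) (insert s(p.1, p.2) E)
    else ((ND n \ E).card : ℝ)⁻¹ *
      ∑ e ∈ ND n \ E, f (d + Pi.single p.1 1 + Pi.single p.2 1) (insert e E)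

/-- expectation under the coupling after `k` steps -/
noncomputable def LL {n : ℕ} : ℕ → ((Fin n → ℕ) → Finset (Sym2 (Fin n)) → ℝ) → ℝ
  | 0, f => f 0 ∅
  | k + 1, f => LL k (KK f)

lemma insert_mem_er {n k : ℕ} {E : Finset (Sym2 (Fin n))} (hE : E ∈ erGraphs n k)
    {e : Sym2 (Fin n)} (he : e ∈ ND n \ E) : insert e E ∈ erGraphs n (k + 1) := by
  rw [erGraphs_eq, mem_powersetCard] at *
  rw [Finset.mem_sdiff] at he
  exact ⟨insert_subset he.1 hE.1, by rw [card_insert_of_notMem he.2, hE.2]⟩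

lemma LL_mono {n : ℕ} (k : ℕ) {f g : (Fin n → ℕ) → Finset (Sym2 (Fin n)) → ℝ}
    (h : ∀ d, ∀ E ∈ erGraphs n k, f d E ≤ g d E) : LL k f ≤ LL k g := by
  induction k generalizing f g with
  | zero => exact h 0 ∅ (by simp [erGraphs_eq])
  | succ k ih =>
    apply ih
    intro d E hE
    unfold KK
    gcongr with p hp
    split_ifs with hp
    · exact h _ _ (insert_mem_er hE hp)
    · gcongr with e he
      exact h _ _ (insert_mem_er hE he)

lemma LL_congr {n : ℕ} (k : ℕ) {f g : (Fin n → ℕ) → Finset (Sym2 (Fin n)) → ℝ}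
    (h : ∀ d, ∀ E ∈ erGraphs n k, f d E = g d E) : LL k f = LL k g :=
  le_antisymm (LL_mono k fun d E hE => (h d E hE).le) (LL_mono k fun d E hE => (h d E hE).ge)

lemma KK_add {n : ℕ} (f g : (Fin n → ℕ) → Finset (Sym2 (Fin n)) → ℝ) :
    KK (fun d E => f d E + g d E) = fun d E => KK f d E + KK g d E := by
  ext d E
  unfold KK
  rw [← mul_add, ← sum_add_distrib]
  congr 1
  apply sum_congr rfl
  intro p _
  split_ifs
  · rfl
  · rw [sum_add_distrib, mul_add]

lemma KK_mul {n : ℕ} (a : ℝ) (f : (Fin n → ℕ) → Finset (Sym2 (Fin n)) → ℝ) :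
    KK (fun d E => a * f d E) = fun d E => a * KK f d E := by
  ext d E
  unfold KK
  rw [mul_left_comm]
  congr 1
  rw [mul_sum]
  apply sum_congr rfl
  intro p _
  split_ifs
  · rfl
  · rw [← mul_sum, mul_left_comm]

lemma LL_add {n : ℕ} (k : ℕ) (f g : (Fin n → ℕ) → Finset (Sym2 (Fin n)) → ℝ) :
    LL k (fun d E => f d E + g d E) = LL k f + LL k g := by
  induction k generalizing f g with
  | zero => rfl
  | succ k ih => simp only [LL, KK_add, ih]

lemma LL_mul {n : ℕ} (k : ℕ) (a : ℝ) (f : (Fin n → ℕ) → Finset (Sym2 (Fin n)) → ℝ) :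
    LL k (fun d E => a * f d E) = a * LL k f := by
  induction k generalizing f with
  | zero => rfl
  | succ k ih => simp only [LL, KK_mul, ih]

lemma card_sdiff_er {n k : ℕ} {E : Finset (Sym2 (Fin n))} (hE : E ∈ erGraphs n k) :
    (ND n \ E).card = (ND n).card - k := by
  rw [erGraphs_eq, mem_powersetCard] at hE
  rw [card_sdiff_of_subset hE.1, hE.2]

lemma LL_fst {n : ℕ} (k : ℕ) (hk : k ≤ (ND n).card) (g : (Fin n → ℕ) → ℝ) :
    LL k (fun d _ => g d) = TT^[2 * k] g 0 := by
  induction k generalizing g with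
  | zero => rfl
  | succ k ih =>
    rw [show 2 * (k + 1) = 2 * k + 1 + 1 by ring, Function.iterate_succ_apply,
      Function.iterate_succ_apply, ← ih (by omega)]
    change LL k (KK _) = LL k _
    apply LL_congr
    intro d E hE
    rw [TT_two]
    unfold KK
    congr 1
    apply sum_congr rfl
    intro p _
    have hpos : ((ND n \ E).card : ℝ) ≠ 0 := by
      rw [card_sdiff_er hE]
      exact_mod_cast (by omega : (ND n).card - k ≠ 0)
    split_ifs
    · rfl
    · rw [sum_const, nsmul_eq_mul, inv_mul_cancel_left₀ hpos]

lemma sum_notin {n : ℕ} (S : Finset (Sym2 (Fin n))) (hS : S ⊆ ND n) (a : ℝ) :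
    ∑ p : Fin n × Fin n, (if s(p.1, p.2) ∈ S then 0 else a) = ((n : ℝ) ^ 2 - 2 * S.card) * a := by
  have h := sum_pairs S hS (fun _ => a)
  have h2 : ∑ p : Fin n × Fin n, ((if s(p.1, p.2) ∈ S then a else 0) +
      (if s(p.1, p.2) ∈ S then 0 else a)) = (n : ℝ) ^ 2 * a := by
    have : ∀ p : Fin n × Fin n, ((if s(p.1, p.2) ∈ S then a else 0) +
      (if s(p.1, p.2) ∈ S then 0 else a)) = a := fun p => by split_ifs <;> simp
    simp only [this]
    rw [sum_const, card_univ, Fintype.card_prod, Fintype.card_fin, nsmul_eq_mul]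
    push_cast; ring
  rw [sum_add_distrib, h, sum_const, nsmul_eq_mul] at h2
  linarith

lemma er_card_succ (n k : ℕ) (hk : k ≤ (ND n).card) :
    ((k : ℝ) + 1) * (erGraphs n (k + 1)).card = (erGraphs n k).card * ((ND n).card - k) := by
  have := double_count (n := n) k (fun _ => 1)
  simp only [sum_const, nsmul_eq_mul, mul_one] at this
  rw [this]
  rw [sum_congr rfl (g := fun _ => ((ND n).card : ℝ) - k)]
  · rw [sum_const, nsmul_eq_mul]
  · intro E hE
    rw [card_sdiff_er hE]
    push_cast [hk]; ring

lemma er_card_pos (n k : ℕ) (hk : k ≤ (ND n).card) : 0 < (erGraphs n k).card := by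
  rw [erGraphs_eq, card_powersetCard]
  exact Nat.choose_pos hk

lemma LL_snd {n : ℕ} (hn : 0 < n) (k : ℕ) (hk : k ≤ (ND n).card) (h : Finset (Sym2 (Fin n)) → ℝ) :
    LL k (fun _ E => h E) = ((erGraphs n k).card : ℝ)⁻¹ * ∑ E ∈ erGraphs n k, h E := by
  have hn' : (0 : ℝ) < n := by exact_mod_cast hn
  induction k generalizing h with
  | zero => simp [LL, erGraphs_eq]
  | succ k ih =>
    change LL k (KK _) = _
    have e : LL k (KK fun (_ : Fin n → ℕ) E => h E) = LL k (fun _ E =>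
        (((ND n).card : ℝ) - k)⁻¹ * ∑ e ∈ ND n \ E, h (insert e E)) := by
      apply LL_congr
      intro d E hE
      have hc := card_sdiff_er hE
      have hc' : ((ND n \ E).card : ℝ) = (ND n).card - k := by
        rw [hc]; push_cast [(by omega : k ≤ (ND n).card)]; ring
      have hpos : (0 : ℝ) < (ND n \ E).card := by
        rw [hc]; exact_mod_cast (by omega : 0 < (ND n).card - k)
      rw [← hc']
      set a := ((ND n \ E).card : ℝ)⁻¹ * ∑ e ∈ ND n \ E, h (insert e E) with ha
      have : ∀ p : Fin n × Fin n, (if s(p.1, p.2) ∈ ND n \ E then h (insert s(p.1, p.2) E) else a)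
        = (if s(p.1, p.2) ∈ ND n \ E then h (insert s(p.1, p.2) E) else 0) +
          (if s(p.1, p.2) ∈ ND n \ E then 0 else a) := fun p => by split_ifs <;> simp
      change ((n : ℝ) ^ 2)⁻¹ * ∑ p : Fin n × Fin n, (if s(p.1, p.2) ∈ ND n \ E then h (insert s(p.1, p.2) E) else a) = a
      simp only [this]
      rw [sum_add_distrib, sum_pairs (ND n \ E) sdiff_subset (fun e => h (insert e E)),
        sum_notin _ sdiff_subset]
      have : ∑ e ∈ ND n \ E, h (insert e E) = (ND n \ E).card * a := by
        rw [ha, mul_inv_cancel_left₀ hpos.ne']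
      rw [this]
      field_simp
      ring
    rw [e, ih (by omega), ← mul_sum, ← double_count]
    have h1 := er_card_succ n k (by omega)
    have h2 : (0 : ℝ) < (erGraphs n k).card := by exact_mod_cast er_card_pos n k (by omega)
    have h3 : (0 : ℝ) < (erGraphs n (k+1)).card := by exact_mod_cast er_card_pos n (k+1) (by omega)
    have h4 : (0 : ℝ) < (ND n).card - k := by
      have : (k : ℝ) + 1 ≤ (ND n).card := by exact_mod_cast hk
      linarith
    field_simp
    linear_combination (∑ E ∈ erGraphs n (k + 1), h E) * h1

lemma KK_theta {n : ℕ} (hn : 0 < n) {k : ℕ} (hk : k < (ND n).card) {θ : ℝ} (hθ : 1 ≤ θ)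
    (d : Fin n → ℕ) {E : Finset (Sym2 (Fin n))} (hE : E ∈ erGraphs n k) :
    KK (fun d E => θ ^ rh d (degr E)) d E ≤
      (1 + θ ^ 4 * ((n + 2 * k) / n ^ 2)) * θ ^ rh d (degr E) := by
  have hn' : (0 : ℝ) < n := by exact_mod_cast hn
  have hc := card_sdiff_er hE
  have hc' : ((ND n \ E).card : ℝ) = (ND n).card - k := by
    rw [hc]; push_cast [hk.le]; ring
  have hpos : (0 : ℝ) < (ND n \ E).card := by
    rw [hc]; exact_mod_cast (by omega : 0 < (ND n).card - k)
  have hr : ∀ (u v : Fin n) (e) , e ∈ ND n \ E →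
      rh (d + Pi.single u 1 + Pi.single v 1) (degr (insert e E)) ≤ rh d (degr E) + 4 := by
    intro u v e he
    induction e with
    | _ a b =>
    simp only [Finset.mem_sdiff, ND, mem_filter, mem_univ, true_and, Sym2.mk_isDiag_iff] at he
    rw [degr_insert _ _ _ he.1 he.2]
    have h1 := rh_single d u
    have h2 := rh_single (d + Pi.single u 1) v
    have h3 := rh_single (degr E) a
    have h4 := rh_single (degr E + Pi.single a 1) b
    have h5 := rh_tri d (degr E) (degr E + Pi.single a 1)
    have h6 := rh_tri d (degr E + Pi.single a 1) (degr E + Pi.single a 1 + Pi.single b 1)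
    have h7 := rh_tri (d + Pi.single u 1) d (degr E + Pi.single a 1 + Pi.single b 1)
    have h8 := rh_tri (d + Pi.single u 1 + Pi.single v 1) (d + Pi.single u 1)
      (degr E + Pi.single a 1 + Pi.single b 1)
    rw [rh_comm] at h1 h2
    omega
  unfold KK
  set X := θ ^ rh d (degr E) with hX
  have hX0 : 0 < X := by positivity
  have hb : ∀ p : Fin n × Fin n, (if s(p.1, p.2) ∈ ND n \ E then
      θ ^ rh (d + Pi.single p.1 1 + Pi.single p.2 1) (degr (insert s(p.1, p.2) E))
    else ((ND n \ E).card : ℝ)⁻¹ *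
      ∑ e ∈ ND n \ E, θ ^ rh (d + Pi.single p.1 1 + Pi.single p.2 1) (degr (insert e E))) ≤
      X + (if s(p.1, p.2) ∈ ND n \ E then 0 else θ ^ 4 * X) := by
    intro p
    split_ifs with hp
    · have hp' := hp
      simp only [Finset.mem_sdiff, ND, mem_filter, mem_univ, true_and, Sym2.mk_isDiag_iff] at hp'
      rw [degr_insert _ _ _ hp'.1 hp'.2, rh_add, rh_add]
      simp [hX]
    · have : ∑ e ∈ ND n \ E, θ ^ rh (d + Pi.single p.1 1 + Pi.single p.2 1) (degr (insert e E))
          ≤ (ND n \ E).card • (θ ^ 4 * X) := by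
        apply sum_le_card_nsmul
        intro e he
        have h9 := pow_le_pow_right₀ hθ (hr p.1 p.2 e he)
        rw [pow_add] at h9
        rw [mul_comm]
        exact h9
      rw [nsmul_eq_mul] at this
      rw [inv_mul_le_iff₀ hpos]
      exact this.trans (mul_le_mul_of_nonneg_left (by linarith) hpos.le)
  refine (mul_le_mul_of_nonneg_left (sum_le_sum fun p _ => hb p) (by positivity)).trans ?_
  rw [sum_add_distrib, sum_notin _ sdiff_subset, hc']
  have h2 := card_ND n
  have : (n : ℝ) ^ 2 - 2 * ((ND n).card - k) = n + 2 * k := by linarith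
  rw [this]
  simp
  apply le_of_eq
  field_simp

lemma LL_theta {n : ℕ} (hn : 0 < n) {m : ℕ} {θ : ℝ} (hθ : 1 ≤ θ) (k : ℕ) (hkm : k ≤ m)
    (hk : k ≤ (ND n).card) :
    LL k (fun (d : Fin n → ℕ) E => θ ^ rh d (degr E)) ≤
      (1 + θ ^ 4 * ((n + 2 * m) / n ^ 2)) ^ k := by
  induction k with
  | zero =>
    have : degr (∅ : Finset (Sym2 (Fin n))) = 0 := by ext v; simp [degr]
    simp [LL, this, rh_self]
  | succ k ih =>
    change LL k (KK _) ≤ _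
    have h1 : LL k (KK fun (d : Fin n → ℕ) E => θ ^ rh d (degr E)) ≤ LL k (fun (d : Fin n → ℕ) E =>
        (1 + θ ^ 4 * ((n + 2 * m) / n ^ 2)) * θ ^ rh d (degr E)) := by
      apply LL_mono
      intro d E hE
      refine (KK_theta hn (by omega) hθ d hE).trans ?_
      have : (k : ℝ) ≤ m := by exact_mod_cast (by omega : k ≤ m)
      gcongr
    rw [LL_mul] at h1
    refine h1.trans ?_
    rw [pow_succ' _ k]
    exact mul_le_mul_of_nonneg_left (ih (by omega) (by omega)) (by positivity)

lemma graph_lower {n : ℕ} (hn : 0 < n) (m r : ℕ) (hm : m ≤ (ND n).card) {θ : ℝ} (hθ : 1 ≤ θ)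
    {U U' : Set (Fin n → ℕ)} (hU : ∀ d e, d ∈ U → rh d e ≤ r → e ∈ U') :
    TT^[2 * m] (ind U) 0 ≤ ((erGraphs n m).card : ℝ)⁻¹ * ∑ E ∈ erGraphs n m, ind U' (degr E)
      + (θ ^ r)⁻¹ * (1 + θ ^ 4 * ((n + 2 * m) / n ^ 2)) ^ m := by
  rw [← LL_fst m hm, ← LL_snd hn m hm (fun E => ind U' (degr E))]
  have h1 : LL m (fun (d : Fin n → ℕ) _ => ind U d) ≤ LL m (fun (d : Fin n → ℕ) E =>
      ind U' (degr E) + (θ ^ r)⁻¹ * θ ^ rh d (degr E)) := by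
    apply LL_mono
    intro d E _
    by_cases h : rh d (degr E) ≤ r
    · have := ind_le (fun hd => hU d (degr E) hd h)
      have : 0 ≤ (θ ^ r)⁻¹ * θ ^ rh d (degr E) := by positivity
      linarith
    · have h2 : 1 ≤ (θ ^ r)⁻¹ * θ ^ rh d (degr E) := by
        rw [le_inv_mul_iff₀ (by positivity), mul_one]
        exact pow_le_pow_right₀ hθ (by omega)
      have := ind_nonneg U' (degr E)
      have := ind_le_one U d
      linarith
  rw [LL_add, LL_mul] at h1
  refine h1.trans ?_
  gcongr
  exact LL_theta hn hθ m le_rfl hm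


/-- empirical measure of a degree sequence -/
noncomputable def tpm {n : ℕ} (d : Fin n → ℕ) : Measure ℕ :=
  (n : ℝ≥0∞)⁻¹ • ∑ v : Fin n, Measure.dirac (d v)

lemma tpm_prob {n : ℕ} (hn : 0 < n) (d : Fin n → ℕ) : IsProbabilityMeasure (tpm d) := by
  constructor
  have h0 : (n : ℝ≥0∞) ≠ 0 := by exact_mod_cast hn.ne'
  simp [tpm, ENNReal.inv_mul_cancel h0]

/-- empirical measure as a probability measure -/
noncomputable def tp {n : ℕ} (hn : 0 < n) (d : Fin n → ℕ) : ProbabilityMeasure ℕ :=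
  ⟨tpm d, tpm_prob hn d⟩

/-- empirical frequencies -/
noncomputable def emf {n : ℕ} (d : Fin n → ℕ) (k : ℕ) : ℝ :=
  (n : ℝ)⁻¹ * ((univ.filter fun v => d v = k).card : ℝ)

lemma em_nonneg {n : ℕ} (d : Fin n → ℕ) (k : ℕ) : 0 ≤ emf d k := by unfold emf; positivity

lemma em_pos {n : ℕ} (hn : 0 < n) (d : Fin n → ℕ) (v : Fin n) : 0 < emf d (d v) := by
  unfold emf
  have : 0 < (univ.filter fun w => d w = d v).card := card_pos.2 ⟨v, by simp⟩
  positivity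

lemma tp_mass {n : ℕ} (hn : 0 < n) (d : Fin n → ℕ) (k : ℕ) :
    ((tp hn d : Measure ℕ) {k}).toReal = emf d k := by
  change ((tpm d) {k}).toReal = _
  simp [tpm, emf, Set.indicator_apply, ENNReal.toReal_mul, ENNReal.toReal_sum, sum_boole]

lemma em_hasSum {n : ℕ} (d : Fin n → ℕ) (φ : ℕ → ℝ) :
    HasSum (fun k => emf d k * φ k) ((n : ℝ)⁻¹ * ∑ v, φ (d v)) := by
  have h : (fun k => emf d k * φ k) = fun k => (n : ℝ)⁻¹ * ∑ v, (if k = d v then φ k else 0) := by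
    ext k
    unfold emf
    rw [mul_assoc]
    congr 1
    rw [← sum_filter, sum_const, nsmul_eq_mul]
    simp only [eq_comm]
  rw [h]
  apply HasSum.mul_left
  apply hasSum_sum
  intro v _
  have := hasSum_ite_eq (d v) (φ (d v))
  have e : (fun k => if k = d v then φ k else 0) = fun k => if k = d v then φ (d v) else 0 := by
    ext k
    split_ifs with h
    · rw [h]
    · rfl
  rw [e]
  exact this

lemma tp_mean {n : ℕ} (hn : 0 < n) (d : Fin n → ℕ) :
    ∑' k : ℕ, (k : ℝ≥0∞) * (tp hn d : Measure ℕ) {k} = ENNReal.ofReal ((∑ v, d v : ℕ) / n) := by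
  have h1 : ∀ k : ℕ, (k : ℝ≥0∞) * (tp hn d : Measure ℕ) {k} = ENNReal.ofReal (emf d k * k) := by
    intro k
    rw [ENNReal.ofReal_mul (em_nonneg _ _), ← tp_mass hn, ENNReal.ofReal_toReal (mass_ne_top _ _)]
    simp [mul_comm]
  have h2 := em_hasSum d (fun k => (k : ℝ))
  simp only [h1]
  rw [← ENNReal.ofReal_tsum_of_nonneg (fun k => mul_nonneg (em_nonneg _ _) (by positivity))
    h2.summable, h2.tsum_eq]
  push_cast
  rw [div_eq_inv_mul]

/-- empirical entropy -/
noncomputable def GG {n : ℕ} (c : ℝ) (d : Fin n → ℕ) : ℝ :=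
  (n : ℝ)⁻¹ * ∑ v, Real.log (emf d (d v) / qc c (d v))

lemma tp_ent {n : ℕ} (hn : 0 < n) {c : ℝ} (hc : 0 < c) (d : Fin n → ℕ) :
    relEntN (tp hn d : Measure ℕ) (poisMeasure c) = ENNReal.ofReal (GG c d) := by
  rw [relEnt_eq hc]
  simp only [tp_mass]
  have h1 := em_hasSum d (fun k => Real.log (emf d k / qc c k))
  have h2 := em_hasSum d (fun k => 1)
  have h3 := (h1.sub h2).add (qc_hasSum c)
  have h4 : (fun k => emf d k * Real.log (emf d k / qc c k) - emf d k * 1 + qc c k)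
    = fun k => hh (qc c k) (emf d k) := by ext k; simp [hh]
  rw [h4] at h3
  rw [← ENNReal.ofReal_tsum_of_nonneg (fun k => hh_nonneg (qc_pos hc k) (em_nonneg _ _))
    h3.summable, h3.tsum_eq]
  congr 1
  have : (n : ℝ) ≠ 0 := by exact_mod_cast hn.ne'
  simp [GG, this]

lemma GG_ge {n : ℕ} (hn : 0 < n) {c : ℝ} (hc : 0 < c) (d : Fin n → ℕ) {a : ℝ≥0}
    (h : (a : ℝ≥0∞) ≤ relEntN (tp hn d : Measure ℕ) (poisMeasure c)) : (0 < a) → (a : ℝ) ≤ GG c d := by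
  intro ha
  rw [tp_ent hn hc, ← ENNReal.ofReal_coe_nnreal] at h
  have ha' : (0 : ℝ) < a := ha
  by_contra hlt
  push Not at hlt
  exact absurd h (not_le.2 ((ENNReal.ofReal_lt_ofReal_iff ha').2 hlt))

lemma prod_qc_GG {n : ℕ} (hn : 0 < n) {c : ℝ} (hc : 0 < c) (d : Fin n → ℕ) :
    ∏ v, qc c (d v) = (∏ v, emf d (d v)) * Real.exp (-(n * GG c d)) := by
  have hn' : (n : ℝ) ≠ 0 := by exact_mod_cast hn.ne'
  unfold GG
  rw [mul_inv_cancel_left₀ hn', ← sum_neg_distrib, Real.exp_sum, ← prod_mul_distrib]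
  apply prod_congr rfl
  intro v _
  have h1 := em_pos hn d v
  have h2 := qc_pos hc (d v)
  rw [Real.exp_neg, Real.exp_log (by positivity)]
  field_simp

/-- type counts -/
def ct {n : ℕ} (N : ℕ) (d : Fin n → ℕ) (k : Fin (N + 1)) : ℕ := (univ.filter fun v => d v = k).card

lemma le_of_antidiag {n N : ℕ} {d : Fin n → ℕ} (hd : d ∈ piAntidiag univ N) (v : Fin n) : d v ≤ N := by
  rw [mem_piAntidiag] at hd
  rw [← hd.1]
  exact single_le_sum (f := d) (fun _ _ => Nat.zero_le _) (mem_univ v)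

lemma em_range_sum {n N : ℕ} (hn : 0 < n) {d : Fin n → ℕ} (hd : d ∈ piAntidiag univ N) :
    ∑ k ∈ range (N + 1), emf d k = 1 := by
  have hn' : (n : ℝ) ≠ 0 := by exact_mod_cast hn.ne'
  unfold emf
  rw [← mul_sum]
  have := card_eq_sum_card_fiberwise (s := (univ : Finset (Fin n))) (f := d) (t := range (N + 1))
    (fun v _ => by simpa [Nat.lt_succ_iff] using le_of_antidiag hd v)
  rw [card_univ, Fintype.card_fin] at this
  have h2 : (n : ℝ) = ∑ k ∈ range (N + 1), ((univ.filter fun v => d v = k).card : ℝ) := by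
    exact_mod_cast this
  rw [← h2, inv_mul_cancel₀ hn']

lemma sum_em_le {n N : ℕ} (hn : 0 < n) :
    ∑ d ∈ piAntidiag (univ : Finset (Fin n)) N, ∏ v, emf d (d v)
      ≤ (((piAntidiag (univ : Finset (Fin n)) N).image (ct N)).card : ℝ) := by
  classical
  rw [← sum_fiberwise_of_maps_to (g := ct N) (t := (piAntidiag (univ : Finset (Fin n)) N).image (ct N))
    (fun d hd => mem_image_of_mem _ hd)]
  rw [card_eq_sum_ones, Nat.cast_sum]
  apply sum_le_sum
  intro τ hτ
  obtain ⟨d₀, hd₀, rfl⟩ := mem_image.1 hτ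
  have h1 : ∀ d ∈ (piAntidiag (univ : Finset (Fin n)) N).filter (fun d => ct N d = ct N d₀),
      ∏ v, emf d (d v) = ∏ v, emf d₀ (d v) := by
    intro d hd
    rw [mem_filter] at hd
    apply prod_congr rfl
    intro v _
    have hv := le_of_antidiag hd.1 v
    have := congrFun hd.2 ⟨d v, by omega⟩
    simp only [ct] at this
    unfold emf
    rw [this]
  rw [sum_congr rfl h1]
  have h2 : ((piAntidiag (univ : Finset (Fin n)) N).filter (fun d => ct N d = ct N d₀)) ⊆
      Fintype.piFinset (fun _ => range (N + 1)) := by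
    intro d hd
    rw [mem_filter] at hd
    rw [Fintype.mem_piFinset]
    intro v
    have := le_of_antidiag hd.1 v
    simp; omega
  refine (sum_le_sum_of_subset_of_nonneg h2 fun d _ _ => prod_nonneg fun _ _ => em_nonneg _ _).trans ?_
  rw [← prod_univ_sum (fun _ : Fin n => range (N + 1)) (fun _ k => emf d₀ k), em_range_sum hn hd₀]
  simp

lemma card_types {n N : ℕ} {x : ℝ} (hx : 0 < x) (hx1 : x < 1) :
    (((piAntidiag (univ : Finset (Fin n)) N).image (ct N)).card : ℝ) * x ^ N ≤
      (n + 1) * Real.exp ((1 - x)⁻¹ * (1 - x)⁻¹) := by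
  have h1 : (((piAntidiag (univ : Finset (Fin n)) N).image (ct N)).card : ℝ) * x ^ N
      ≤ ∏ k : Fin (N + 1), ∑ j ∈ range (n + 1), x ^ ((k : ℕ) * j) := by
    rw [prod_univ_sum, ← nsmul_eq_mul, ← sum_const]
    have h2 : (piAntidiag (univ : Finset (Fin n)) N).image (ct N) ⊆
        Fintype.piFinset (fun _ => range (n + 1)) := by
      intro τ hτ
      obtain ⟨d, hd, rfl⟩ := mem_image.1 hτ
      rw [Fintype.mem_piFinset]
      intro k
      have : (univ.filter fun v => d v = k).card ≤ _ := card_filter_le _ _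
      simp at this
      simp [ct]; omega
    refine le_trans (sum_le_sum ?_) (sum_le_sum_of_subset_of_nonneg h2 fun d _ _ =>
      prod_nonneg fun _ _ => by positivity)
    intro τ hτ
    obtain ⟨d, hd, rfl⟩ := mem_image.1 hτ
    rw [prod_pow_eq_pow_sum]
    apply le_of_eq
    congr 1
    have hd' := hd
    rw [mem_piAntidiag] at hd
    refine Eq.trans ?_ (Fin.sum_univ_eq_sum_range
      (fun k => k * (univ.filter fun v => d v = k).card) (N + 1)).symm
    refine hd.1.symm.trans ?_
    rw [← sum_fiberwise_of_maps_to (g := d) (t := range (N + 1))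
      (fun v _ => by simpa [Nat.lt_succ_iff] using le_of_antidiag hd' v)]
    apply sum_congr rfl
    intro k _
    rw [sum_congr rfl (g := fun _ => k) (fun v hv => (mem_filter.1 hv).2), sum_const, smul_eq_mul,
      mul_comm]
  refine h1.trans ?_
  have hy : 0 < 1 - x := by linarith
  rw [Fin.prod_univ_succ]
  have e0 : ∑ j ∈ range (n + 1), x ^ (((0 : Fin (N + 1)) : ℕ) * j) = (n : ℝ) + 1 := by simp
  rw [e0]
  apply mul_le_mul_of_nonneg_left _ (by positivity)
  have h3 : ∀ k : Fin N, ∑ j ∈ range (n + 1), x ^ (((k.succ : Fin (N + 1)) : ℕ) * j) ≤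
      Real.exp ((1 - x)⁻¹ * x ^ (k : ℕ)) := by
    intro k
    simp only [pow_mul, Fin.val_succ]
    have hk0 : 0 < x ^ ((k : ℕ) + 1) := by positivity
    have hk1 : x ^ ((k : ℕ) + 1) ≤ x := by
      calc x ^ ((k : ℕ) + 1) ≤ x ^ 1 := pow_le_pow_of_le_one hx.le hx1.le (by omega)
        _ = x := pow_one x
    have hk2 : x ^ ((k : ℕ) + 1) ≤ x ^ (k : ℕ) := pow_le_pow_of_le_one hx.le hx1.le (by omega)
    set y := x ^ ((k : ℕ) + 1) with hyd
    have hs : ∑ j ∈ range (n + 1), y ^ j ≤ (1 - y)⁻¹ := by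
      have := (hasSum_geometric_of_lt_one hk0.le (by linarith))
      exact sum_le_hasSum _ (fun i _ => by positivity) this
    refine hs.trans ?_
    have h5 : (1 - y)⁻¹ = (1 - y)⁻¹ * y + 1 := by
      have : 1 - y ≠ 0 := by linarith
      field_simp; ring
    rw [h5]
    refine (Real.add_one_le_exp _).trans (Real.exp_le_exp.2 ?_)
    have : (1 - y)⁻¹ ≤ (1 - x)⁻¹ := inv_anti₀ hy (by linarith)
    gcongr
  refine (prod_le_prod (fun k _ => sum_nonneg fun j _ => by positivity) fun k _ => h3 k).trans ?_
  rw [← Real.exp_sum, ← mul_sum]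
  apply Real.exp_le_exp.2
  gcongr
  rw [Fin.sum_univ_eq_sum_range (fun k => x ^ k)]
  exact sum_le_hasSum _ (fun i _ => by positivity) (hasSum_geometric_of_lt_one hx.le hx1)

lemma fact_aux (N : ℕ) : ((N + 1).factorial : ℝ) ≤
    Real.exp 1 * (N + 1) * (((N : ℝ) + 1) ^ (N + 1) * Real.exp (-(N + 1))) := by
  induction N with
  | zero => simp [← Real.exp_add]
  | succ N ih =>
    rw [Nat.factorial_succ]
    push_cast
    set y : ℝ := (N : ℝ) + 1 with hy
    have hy0 : 0 < y := by positivity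
    have h1 : y / (y + 1) ≤ Real.exp (-(1 / (y + 1))) := by
      have := Real.add_one_le_exp (-(1 / (y + 1)))
      refine le_trans (le_of_eq ?_) this
      field_simp
      ring
    have h2 : (y / (y + 1)) ^ (N + 1 + 1) ≤ Real.exp (-1) := by
      refine (pow_le_pow_left₀ (by positivity) h1 _).trans (le_of_eq ?_)
      rw [← Real.exp_nat_mul]
      congr 1
      push_cast
      rw [← hy]
      field_simp
    rw [div_pow, div_le_iff₀ (by positivity)] at h2
    calc (y + 1) * ((N + 1).factorial : ℝ)
        ≤ (y + 1) * (Real.exp 1 * y * (y ^ (N + 1) * Real.exp (-y))) := by gcongr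
      _ = Real.exp 1 * (y + 1) * Real.exp (-y) * y ^ (N + 1 + 1) := by ring
      _ ≤ Real.exp 1 * (y + 1) * Real.exp (-y) * (Real.exp (-1) * (y + 1) ^ (N + 1 + 1)) := by gcongr
      _ = _ := by rw [show -(y + 1) = -y + -1 by ring, Real.exp_add]; ring

lemma fact_le (N : ℕ) : (N.factorial : ℝ) ≤ Real.exp 1 * (N + 1) * ((N : ℝ) ^ N * Real.exp (-N)) := by
  rcases N with _ | N
  · simp
  · refine (fact_aux N).trans ?_
    push_cast
    gcongr
    linarith

lemma inv_qc {n N : ℕ} (hn : 0 < n) {c : ℝ} (hc : 0 < c) :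
    (qc (c * n) N)⁻¹ ≤ Real.exp 1 * (N + 1) * Real.exp (n * hh c (N / n)) := by
  have hn' : (0 : ℝ) < n := by exact_mod_cast hn
  have h : Real.exp (n * hh c (N / n)) = (N : ℝ) ^ N * Real.exp (-N) * (Real.exp (c * n) / (c * n) ^ N) := by
    rcases Nat.eq_zero_or_pos N with rfl | hN
    · simp [hh, mul_comm]
    · have hN' : (0 : ℝ) < N := by exact_mod_cast hN
      have e : n * hh c (N / n) = Real.log ((N / (n * c)) ^ N) + (-N) + c * n := by
        unfold hh
        rw [Real.log_pow, div_div]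
        field_simp
        ring
      rw [e, Real.exp_add, Real.exp_add, Real.exp_log (by positivity), div_pow, mul_comm (n : ℝ) c]
      field_simp
  rw [h]
  unfold qc
  rw [Real.exp_neg]
  have := fact_le N
  have h2 : (0 : ℝ) < Real.exp (c * n) / (c * n) ^ N := by positivity
  calc ((Real.exp (c * n))⁻¹ * (c * n) ^ N / N.factorial)⁻¹
      = N.factorial * (Real.exp (c * n) / (c * n) ^ N) := by field_simp
    _ ≤ _ := by
      have := mul_le_mul_of_nonneg_right this h2.le
      linarith

lemma TT_upper {n N : ℕ} (hn : 0 < n) {c x a : ℝ} (hc : 0 < c) (hx : 0 < x) (hx1 : x < 1)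
    {S : Set (Fin n → ℕ)} (hS : ∀ d ∈ S, ∑ v, d v = N → a ≤ GG c d) :
    TT^[N] (ind S) 0 ≤ (Real.exp 1 * (N + 1) * Real.exp (n * hh c (N / n))) *
      (Real.exp (-(n * a)) * ((n + 1) * Real.exp ((1 - x)⁻¹ * (1 - x)⁻¹) * (x ^ N)⁻¹)) := by
  have hn' : (0 : ℝ) < n := by exact_mod_cast hn
  have hq : 0 < qc (c * n) N := qc_pos (by positivity) N
  have h := pois_TT hn (c := c) N (ind S)
  have e : TT^[N] (ind S) 0 = (qc (c * n) N)⁻¹ *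
      ∑ d ∈ piAntidiag univ N, ind S d * ∏ v, qc c (d v) := by
    rw [h, inv_mul_cancel_left₀ hq.ne']
  rw [e]
  apply mul_le_mul (inv_qc hn hc) _ _ (by positivity)
  · have h1 : ∀ d ∈ piAntidiag (univ : Finset (Fin n)) N, ind S d * ∏ v, qc c (d v) ≤
        Real.exp (-(n * a)) * ∏ v, emf d (d v) := by
      intro d hd
      have hp : 0 ≤ ∏ v, emf d (d v) := prod_nonneg fun _ _ => em_nonneg _ _
      by_cases hdS : d ∈ S
      · rw [prod_qc_GG hn hc]
        have := hS d hdS (mem_piAntidiag.1 hd).1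
        simp only [ind, hdS, if_true, one_mul]
        rw [mul_comm]
        gcongr
      · simp only [ind, hdS, if_false, zero_mul]
        positivity
    refine (sum_le_sum h1).trans ?_
    rw [← mul_sum]
    gcongr
    refine (sum_em_le hn).trans ?_
    rw [← div_eq_mul_inv, le_div_iff₀ (by positivity)]
    exact card_types hx hx1
  · exact sum_nonneg fun d _ => mul_nonneg (ind_nonneg _ _) (prod_nonneg fun _ _ => (qc_pos hc _).le)

lemma er_card_lower {n m : ℕ} (h : (n : ℝ) + 2 * m ≤ n ^ 2) (k : ℕ) (hk : k ≤ m) :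
    ((n : ℝ) ^ 2 - n - 2 * m) ^ k ≤ 2 ^ k * k.factorial * (erGraphs n k).card := by
  induction k with
  | zero => simp [erGraphs_eq]
  | succ k ih =>
    have h1 := ih (by omega)
    have h3 := card_ND n
    have hkm : (k : ℝ) + 1 ≤ m := by exact_mod_cast hk
    have hk' : k ≤ (ND n).card := by
      have : (k : ℝ) ≤ (ND n).card := by linarith
      exact_mod_cast this
    have h2 := er_card_succ n k hk'
    rw [pow_succ, Nat.factorial_succ]
    push_cast
    calc ((n : ℝ) ^ 2 - n - 2 * m) ^ k * ((n : ℝ) ^ 2 - n - 2 * m)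
        ≤ (2 ^ k * k.factorial * (erGraphs n k).card) * (2 * ((ND n).card - k)) := by
          apply mul_le_mul h1 (by linarith) (by linarith) (by positivity)
      _ = 2 ^ k * k.factorial * 2 * ((erGraphs n k).card * ((ND n).card - k)) := by ring
      _ = _ := by rw [← h2]; ring

lemma graph_upper' {n m : ℕ} (hn : 0 < n) (h : 2 * ((n : ℝ) + 2 * m) ≤ n ^ 2)
    (f : (Fin n → ℕ) → ℝ) (hf : ∀ d, 0 ≤ f d) :
    ((erGraphs n m).card : ℝ)⁻¹ * ∑ E ∈ erGraphs n m, f (degr E) ≤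
      Real.exp (2 * (n + 2 * m) / n ^ 2 * m) * TT^[2 * m] f 0 := by
  have hn' : (0 : ℝ) < n := by exact_mod_cast hn
  have h1 := graph_upper hn m f hf
  have hT : 0 ≤ TT^[2 * m] f 0 := by
    have := le_TT_iter hn (f := f) (2 * m) 0 0
    by_contra hlt
    push Not at hlt
    have h2 : (0 : ℝ) ≤ 2 ^ m * m.factorial * ∑ E ∈ erGraphs n m, f (degr E) :=
      mul_nonneg (by positivity) (sum_nonneg fun _ _ => hf _)
    have h3 : (0 : ℝ) < ((n : ℝ) ^ 2) ^ m := by positivity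
    nlinarith
  have h2 := er_card_lower (n := n) (m := m) (by nlinarith) m le_rfl
  have hpos : (0 : ℝ) < n ^ 2 - n - 2 * m := by nlinarith
  have hER : (0 : ℝ) < (erGraphs n m).card := by
    have : (0 : ℝ) < ((n : ℝ) ^ 2 - n - 2 * m) ^ m := by positivity
    by_contra hlt
    push Not at hlt
    have h3 : (0 : ℝ) < 2 ^ m * m.factorial := by positivity
    nlinarith
  have h3 : ((n : ℝ) ^ 2) ^ m ≤ Real.exp (2 * (n + 2 * m) / n ^ 2 * m) *
      ((n : ℝ) ^ 2 - n - 2 * m) ^ m := by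
    rw [mul_comm _ (m : ℝ), Real.exp_nat_mul, ← mul_pow]
    apply pow_le_pow_left₀ (by positivity)
    have e := Real.add_one_le_exp (2 * (n + 2 * m) / (n : ℝ) ^ 2)
    refine le_trans ?_ (mul_le_mul_of_nonneg_right e hpos.le)
    rw [div_add_one (by positivity), div_mul_eq_mul_div, le_div_iff₀ (by positivity)]
    set y : ℝ := (n : ℝ) + 2 * m with hy
    have : (n : ℝ) ^ 2 - n - 2 * m = n ^ 2 - y := by rw [hy]; ring
    rw [this]
    have hy0 : 0 < y := by positivity
    nlinarith
  rw [inv_mul_le_iff₀ hER]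
  have h4 : (0 : ℝ) < 2 ^ m * m.factorial := by positivity
  rw [← mul_le_mul_iff_right₀ h4]
  refine h1.trans ((mul_le_mul_of_nonneg_right h3 hT).trans ?_)
  calc _ ≤ Real.exp (2 * (n + 2 * m) / n ^ 2 * m) * (2 ^ m * m.factorial * (erGraphs n m).card) * TT^[2 * m] f 0 := by
        gcongr
    _ = _ := by ring


/-- probability that the degree sequence lies in `S` -/
noncomputable def PP (n m : ℕ) (S : Set (Fin n → ℕ)) : ℝ :=
  ((erGraphs n m).card : ℝ)⁻¹ * ∑ E ∈ erGraphs n m, ind S (degr E)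

lemma log_div_tendsto : Tendsto (fun n : ℕ => Real.log (n + 1) / n) atTop (𝓝 0) := by
  have h := Real.tendsto_pow_log_div_mul_add_atTop 1 (-1) 1 one_ne_zero
  have h2 : Tendsto (fun n : ℕ => (n : ℝ) + 1) atTop atTop :=
    tendsto_atTop_add_const_right _ _ tendsto_natCast_atTop_atTop
  have := h.comp h2
  refine this.congr fun n => ?_
  simp

lemma upper_asym {c : ℝ} (hc : 0 < c) {lam : ℕ → ℕ}
    (hs : Tendsto (fun n : ℕ => ((2 * lam n : ℕ) : ℝ) / n) atTop (𝓝 c)) {a a' : ℝ} (ha : a < a')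
    (S : ∀ n, Set (Fin n → ℕ))
    (hS : ∀ᶠ n in atTop, ∀ d ∈ S n, ∑ v, d v = 2 * lam n → a' ≤ GG c d) :
    ∀ᶠ n : ℕ in atTop, PP n (lam n) (S n) ≤ Real.exp (-(n * a)) := by
  set b : ℝ := (a' - a) / (2 * c) with hb
  have hb0 : 0 < b := div_pos (by linarith) (by linarith)
  set x : ℝ := Real.exp (-b) with hx
  have hx0 : 0 < x := Real.exp_pos _
  have hx1 : x < 1 := by rw [hx, Real.exp_lt_one_iff]; linarith
  set C : ℝ := (1 - x)⁻¹ * (1 - x)⁻¹ with hC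
  set s : ℕ → ℝ := fun n => ((2 * lam n : ℕ) : ℝ) / n with hsd
  have hF : Tendsto (fun n : ℕ => ((1 + s n) * s n + 1 + s n + C) / n + 2 * (Real.log (n + 1) / n)
      + hh c (s n) + b * s n) atTop (𝓝 (0 + 2 * 0 + hh c c + b * c)) := by
    refine Tendsto.add (Tendsto.add (Tendsto.add ?_ (log_div_tendsto.const_mul 2)) ?_) (hs.const_mul b)
    · have h1 : Tendsto (fun n => (1 + s n) * s n + 1 + s n + C) atTop (𝓝 ((1 + c) * c + 1 + c + C)) :=
        ((((hs.const_add 1).mul hs).add_const 1).add hs).add_const C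
      exact h1.div_atTop tendsto_natCast_atTop_atTop
    · exact ((hh_cont hc).tendsto c).comp hs
  have hlim : 0 + 2 * 0 + hh c c + b * c < a' - a := by
    have : hh c c = 0 := by simp [hh, hc.ne']
    rw [this, hb]
    have : (a' - a) / (2 * c) * c = (a' - a) / 2 := by field_simp
    rw [this]; linarith
  have hF2 := hF.eventually (gt_mem_nhds hlim)
  have hn2 : ∀ᶠ n : ℕ in atTop, 2 * (1 + s n) ≤ n := by
    have h1 : ∀ᶠ n : ℕ in atTop, s n < c + 1 := hs.eventually (gt_mem_nhds (by linarith))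
    have h2 : ∀ᶠ n : ℕ in atTop, 2 * (1 + (c + 1)) ≤ (n : ℝ) :=
      tendsto_natCast_atTop_atTop.eventually_ge_atTop _
    filter_upwards [h1, h2] with n h1 h2
    linarith
  filter_upwards [hF2, hn2, hS, eventually_gt_atTop 0] with n hFn hn2 hSn hn
  have hn' : (0 : ℝ) < n := by exact_mod_cast hn
  have hN : ((2 * lam n : ℕ) : ℝ) = n * s n := by simp only [hsd]; field_simp
  have hN' : 2 * (lam n : ℝ) = n * s n := by rw [← hN]; push_cast; ring
  have hs0 : 0 ≤ s n := by simp only [hsd]; positivity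
  have h1 := graph_upper' hn (m := lam n) (by rw [hN']; nlinarith) (ind (S n)) (fun d => ind_nonneg _ _)
  have h2 := TT_upper hn (N := 2 * lam n) (c := c) (x := x) (a := a') hc hx0 hx1 hSn
  change PP n (lam n) (S n) ≤ _ at h1
  refine h1.trans ((mul_le_mul_of_nonneg_left h2 (Real.exp_pos _).le).trans ?_)
  have e1 : 2 * (n + 2 * (lam n : ℝ)) / n ^ 2 * lam n = (1 + s n) * s n := by
    have : (lam n : ℝ) = n * s n / 2 := by linarith
    rw [this]
    field_simp
  have e2 : (x ^ (2 * lam n))⁻¹ = Real.exp (n * (b * s n)) := by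
    rw [hx, ← Real.exp_nat_mul, ← Real.exp_neg]
    congr 1
    rw [hN]; ring
  have e3 : ((2 * lam n : ℕ) : ℝ) + 1 ≤ Real.exp (Real.log (n + 1)) * Real.exp (s n) := by
    rw [Real.exp_log (by positivity), hN]
    have := Real.add_one_le_exp (s n)
    nlinarith
  have e4 : ((n : ℝ) + 1) = Real.exp (Real.log (n + 1)) := by rw [Real.exp_log (by positivity)]
  have e5 : ((2 * lam n : ℕ) : ℝ) / n = s n := rfl
  rw [e1, e2, e5, ← hC]
  calc Real.exp ((1 + s n) * s n) * (Real.exp 1 * (((2 * lam n : ℕ) : ℝ) + 1) * Real.exp (n * hh c (s n)) *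
      (Real.exp (-(n * a')) * (((n : ℝ) + 1) * Real.exp C * Real.exp (n * (b * s n)))))
      ≤ Real.exp ((1 + s n) * s n) * (Real.exp 1 * (Real.exp (Real.log (n + 1)) * Real.exp (s n)) * Real.exp (n * hh c (s n)) *
      (Real.exp (-(n * a')) * (Real.exp (Real.log (n + 1)) * Real.exp C * Real.exp (n * (b * s n))))) := by
        rw [← e4] at e3 ⊢
        gcongr
    _ = Real.exp (n * (((1 + s n) * s n + 1 + s n + C) / n + 2 * (Real.log (n + 1) / n)
      + hh c (s n) + b * s n) - n * a') := by
        simp only [← Real.exp_add]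
        congr 1
        field_simp
        ring
    _ ≤ _ := by
        apply Real.exp_le_exp.2
        nlinarith


/-- point masses -/
noncomputable def pm (δ : ProbabilityMeasure ℕ) (k : ℕ) : ℝ := ((δ : Measure ℕ) {k}).toReal

lemma pm_nonneg (δ : ProbabilityMeasure ℕ) (k : ℕ) : 0 ≤ pm δ k := ENNReal.toReal_nonneg

lemma pm_integrable (δ : ProbabilityMeasure ℕ) (φ : ℕ → ℝ) {a : ℝ}
    (h : HasSum (fun k => pm δ k * φ k) a) :
    Integrable φ (δ : Measure ℕ) ∧ ∫ k, φ k ∂(δ : Measure ℕ) = a := by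
  have hi : Integrable φ (δ : Measure ℕ) := by
    refine ⟨(measurable_of_countable φ).aestronglyMeasurable, ?_⟩
    unfold HasFiniteIntegral
    rw [lintegral_countable']
    have h1 : ∀ k, ‖φ k‖ₑ * (δ : Measure ℕ) {k} = ENNReal.ofReal |pm δ k * φ k| := by
      intro k
      rw [abs_mul, abs_of_nonneg (pm_nonneg _ _), ENNReal.ofReal_mul (pm_nonneg _ _), pm,
        ENNReal.ofReal_toReal (mass_ne_top _ _), mul_comm, Real.enorm_eq_ofReal_abs]
    simp only [h1]
    rw [← ENNReal.ofReal_tsum_of_nonneg (fun k => abs_nonneg _) h.summable.abs]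
    exact ENNReal.ofReal_lt_top
  refine ⟨hi, ?_⟩
  rw [integral_countable hi]
  rw [← h.tsum_eq]
  rfl

/-- i.i.d. sequences -/
noncomputable abbrev PI (δ : ProbabilityMeasure ℕ) : Measure (ℕ → ℕ) :=
  Measure.infinitePi (fun _ : ℕ => (δ : Measure ℕ))

lemma slln (δ : ProbabilityMeasure ℕ) (φ : ℕ → ℝ) {a : ℝ}
    (h : HasSum (fun k => pm δ k * φ k) a) :
    ∀ᵐ ω ∂(PI δ), Tendsto (fun n : ℕ => (n : ℝ)⁻¹ * ∑ v : Fin n, φ (ω v)) atTop (𝓝 a) := by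
  obtain ⟨hi, hIn⟩ := pm_integrable δ φ h
  have hm : ∀ i : ℕ, MeasurePreserving (Function.eval i) (PI δ) (δ : Measure ℕ) := fun i =>
    measurePreserving_eval_infinitePi (fun _ : ℕ => (δ : Measure ℕ)) i
  have hφ : Measurable φ := measurable_of_countable φ
  have hind := ProbabilityTheory.iIndepFun_infinitePi (P := fun _ : ℕ => (δ : Measure ℕ))
    (X := fun _ => φ) (fun _ => hφ)
  have key := ProbabilityTheory.strong_law_ae_real (μ := PI δ) (fun i ω => φ (ω i))
    (by exact (hm 0).integrable_comp_of_integrable hi)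
    (fun i j hij => hind.indepFun hij)
    (fun i => ⟨(hφ.comp (measurable_pi_apply i)).aemeasurable, (hφ.comp (measurable_pi_apply 0)).aemeasurable, by
      have h1 : ∀ j, Measure.map (fun ω : ℕ → ℕ => φ (ω j)) (PI δ) = Measure.map φ (δ : Measure ℕ) := by
        intro j
        rw [← (hm j).map_eq, Measure.map_map hφ (hm j).measurable]
        rfl
      rw [h1, h1]⟩)
  have hIn' : ∫ ω, φ (ω 0) ∂(PI δ) = a := by
    rw [← hIn, ← (hm 0).map_eq]
    rw [integral_map (hm 0).measurable.aemeasurable hφ.aestronglyMeasurable]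
  rw [hIn'] at key
  filter_upwards [key] with ω hω
  refine hω.congr fun n => ?_
  rw [Fin.sum_univ_eq_sum_range (fun i => φ (ω i)), div_eq_inv_mul]

lemma cyl_prob (δ : ProbabilityMeasure ℕ) (n : ℕ) (d : Fin n → ℕ) :
    PI δ {ω | (fun v : Fin n => ω v) = d} = ENNReal.ofReal (∏ v, pm δ (d v)) := by
  have h := Measure.infinitePi_pi (fun _ : ℕ => (δ : Measure ℕ)) (s := range n)
    (t := fun i => if hi : i < n then {d ⟨i, hi⟩} else Set.univ) (fun i _ => MeasurableSet.of_discrete)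
  have e : {ω : ℕ → ℕ | (fun v : Fin n => ω v) = d} = (↑(range n) : Set ℕ).pi
      (fun i => if hi : i < n then {d ⟨i, hi⟩} else Set.univ) := by
    ext ω
    simp only [Set.mem_setOf_eq, Set.mem_pi, mem_coe, mem_range]
    constructor
    · rintro rfl i hi
      simp [hi]
    · intro hω
      ext v
      have := hω v v.2
      simpa using this
  rw [e, h, ENNReal.ofReal_prod_of_nonneg (fun _ _ => pm_nonneg _ _),
    ← Fin.prod_univ_eq_prod_range (fun i => (δ : Measure ℕ) (if hi : i < n then {d ⟨i, hi⟩} else Set.univ)) n]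
  apply prod_congr rfl
  intro v _
  simp [pm]

lemma cyl_union (δ : ProbabilityMeasure ℕ) (n : ℕ) (W : Finset (Fin n → ℕ)) :
    PI δ {ω | (fun v : Fin n => ω v) ∈ W} ≤ ENNReal.ofReal (∑ d ∈ W, ∏ v, pm δ (d v)) := by
  have e : {ω : ℕ → ℕ | (fun v : Fin n => ω v) ∈ W} = ⋃ d ∈ W, {ω | (fun v : Fin n => ω v) = d} := by
    ext ω; simp
  rw [e]
  refine (measure_biUnion_finset_le _ _).trans ?_
  simp only [cyl_prob]
  rw [ENNReal.ofReal_sum_of_nonneg (fun _ _ => prod_nonneg fun _ _ => pm_nonneg _ _)]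

lemma emf_eq {n : ℕ} (d : Fin n → ℕ) (k : ℕ) :
    emf d k = (n : ℝ)⁻¹ * ∑ v, (if d v = k then 1 else 0) := by
  unfold emf; simp

lemma emf_rh {n : ℕ} (hn : 0 < n) (d e : Fin n → ℕ) (k : ℕ) {r : ℕ} (h : rh d e ≤ r) :
    |emf e k - emf d k| ≤ r / n := by
  have hn' : (0 : ℝ) < n := by exact_mod_cast hn
  rw [emf_eq, emf_eq, ← mul_sub, ← sum_sub_distrib, abs_mul, abs_of_pos (by positivity),
    div_eq_inv_mul]
  gcongr
  refine (abs_sum_le_sum_abs _ _).trans ?_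
  have h' : (rh d e : ℝ) ≤ r := by exact_mod_cast h
  refine le_trans ?_ h'
  unfold rh
  push_cast
  apply sum_le_sum
  intro v _
  by_cases hv : d v = e v
  · simp [hv]
  · have h1 : (1 : ℝ) ≤ (((d v : ℤ) - e v).natAbs : ℝ) := by
      have : 1 ≤ ((d v : ℤ) - e v).natAbs := by omega
      exact_mod_cast this
    have h2 : |(if e v = k then (1 : ℝ) else 0) - (if d v = k then 1 else 0)| ≤ 1 := by
      split_ifs <;> simp
    exact h2.trans h1

lemma TT_lower {n : ℕ} (hn : 0 < n) {c : ℝ} (hc : 0 < c) {U U' : Set (Fin n → ℕ)} {r N : ℕ}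
    (hU : ∀ d e, d ∈ U → rh d e ≤ r → e ∈ U') :
    ∑ M ∈ Icc (N - r) (N + r), ∑ d ∈ piAntidiag univ M, ind U d * ∏ v, qc c (d v)
      ≤ TT^[N] (ind U') 0 := by
  have hn' : (0 : ℝ) < n := by exact_mod_cast hn
  have hT : 0 ≤ TT^[N] (ind U') 0 := le_TT_iter hn _ _ _ fun _ _ => ind_nonneg _ _
  have h1 : ∀ M ∈ Icc (N - r) (N + r), ∑ d ∈ piAntidiag univ M, ind U d * ∏ v, qc c (d v)
      ≤ qc (c * n) M * TT^[N] (ind U') 0 := by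
    intro M hM
    rw [mem_Icc] at hM
    rw [pois_TT hn]
    exact mul_le_mul_of_nonneg_left (TT_shift hn hU (by omega) (by omega)) (qc_pos (by positivity) _).le
  refine (sum_le_sum h1).trans ?_
  rw [← sum_mul]
  have h2 : ∑ M ∈ Icc (N - r) (N + r), qc (c * n) M ≤ 1 :=
    sum_le_hasSum _ (fun M _ => (qc_pos (by positivity) M).le) (qc_hasSum (c * n))
  nlinarith

lemma prod_change {n : ℕ} {c : ℝ} (hc : 0 < c) (δ : ProbabilityMeasure ℕ)
    (d : Fin n → ℕ) {b : ℝ} (h : ∑ v, Real.log (pm δ (d v) / qc c (d v)) ≤ b) :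
    Real.exp (-b) * ∏ v, pm δ (d v) ≤ ∏ v, qc c (d v) := by
  have hq : 0 < ∏ v, qc c (d v) := prod_pos fun v _ => qc_pos hc _
  by_cases hz : ∃ v, pm δ (d v) = 0
  · obtain ⟨v, hv⟩ := hz
    rw [prod_eq_zero (mem_univ v) hv, mul_zero]
    exact hq.le
  · push Not at hz
    have hp : ∀ v, 0 < pm δ (d v) := fun v => lt_of_le_of_ne (pm_nonneg _ _) (hz v).symm
    rw [Real.exp_neg, inv_mul_le_iff₀ (Real.exp_pos _)]
    have e : ∏ v, pm δ (d v) = Real.exp (∑ v, Real.log (pm δ (d v) / qc c (d v))) * ∏ v, qc c (d v) := by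
      rw [Real.exp_sum, ← prod_mul_distrib]
      apply prod_congr rfl
      intro v _
      have := qc_pos hc (d v)
      rw [Real.exp_log (div_pos (hp v) this)]
      field_simp
    rw [e]
    gcongr

lemma good_prob {c : ℝ} (δ : ProbabilityMeasure ℕ) {h ε : ℝ} (hε : 0 < ε) (K : ℕ)
    (hmean : HasSum (fun k => pm δ k * (k : ℝ)) c)
    (hent : HasSum (fun k => pm δ k * Real.log (pm δ k / qc c k)) h) :
    ∀ᶠ n : ℕ in atTop, (1 / 2 : ℝ≥0∞) ≤ PI δ {ω | (fun v : Fin n => ω v) ∈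
      {d : Fin n → ℕ | (∀ k < K, |emf d k - pm δ k| < ε) ∧
        (n : ℝ)⁻¹ * ∑ v, Real.log (pm δ (d v) / qc c (d v)) < h + ε ∧
        |(n : ℝ)⁻¹ * ∑ v, (d v : ℝ) - c| < ε}} := by
  have hlim := tendsto_measure_of_ae_tendsto_indicator_of_isFiniteMeasure (μ := PI δ) atTop
    (A := Set.univ) (As := fun n : ℕ => {ω | (fun v : Fin n => ω v) ∈
      {d : Fin n → ℕ | (∀ k < K, |emf d k - pm δ k| < ε) ∧
        (n : ℝ)⁻¹ * ∑ v, Real.log (pm δ (d v) / qc c (d v)) < h + ε ∧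
        |(n : ℝ)⁻¹ * ∑ v, (d v : ℝ) - c| < ε}}) MeasurableSet.univ ?_ ?_
  · rw [measure_univ] at hlim
    have : (1 / 2 : ℝ≥0∞) < 1 := by simp
    filter_upwards [hlim.eventually (lt_mem_nhds this)] with n hn
    exact hn.le
  · intro n
    have : Measurable (fun (ω : ℕ → ℕ) (v : Fin n) => ω v) := by fun_prop
    exact this MeasurableSet.of_discrete
  · have h1 := slln δ (fun k => (k : ℝ)) hmean
    have h2 := slln δ (fun k => Real.log (pm δ k / qc c k)) hent
    have h3 : ∀ᵐ ω ∂(PI δ), ∀ k : ℕ, Tendsto (fun n : ℕ => emf (fun v : Fin n => ω v) k) atTop (𝓝 (pm δ k)) := by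
      rw [ae_all_iff]
      intro k
      have hk : HasSum (fun j => pm δ j * (if j = k then 1 else 0)) (pm δ k) := by
        have e : (fun j => pm δ j * (if j = k then 1 else 0)) = fun j => if j = k then pm δ k else 0 := by
          ext j
          split_ifs with hj
          · rw [hj, mul_one]
          · simp
        rw [e]
        exact hasSum_ite_eq k (pm δ k)
      filter_upwards [slln δ (fun j => if j = k then 1 else 0) hk] with ω hω
      refine hω.congr fun n => ?_
      rw [emf_eq]
    filter_upwards [h1, h2, h3] with ω h1 h2 h3
    have g1 := h1.eventually (Metric.ball_mem_nhds c hε)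
    have g2 := h2.eventually (gt_mem_nhds (by linarith : h < h + ε))
    have g3 : ∀ᶠ n : ℕ in atTop, ∀ k ∈ range K, |emf (fun v : Fin n => ω v) k - pm δ k| < ε := by
      rw [eventually_all_finset]
      intro k _
      exact (h3 k).eventually (Metric.ball_mem_nhds (pm δ k) hε)
    filter_upwards [g1, g2, g3] with n g1 g2 g3
    simp only [Set.mem_univ, iff_true]
    refine ⟨fun k hk => g3 k (mem_range.2 hk), g2, ?_⟩
    simpa [Real.dist_eq] using g1


lemma good_sum {n : ℕ} (hn : 0 < n) {c : ℝ} (hc : 0 < c) (δ : ProbabilityMeasure ℕ) {h ε : ℝ}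
    (K : ℕ) {r N : ℕ} (hr : ∀ M : ℕ, |(n : ℝ)⁻¹ * M - c| < ε → M ≤ N + r ∧ N ≤ M + r)
    (hp : (1 / 2 : ℝ≥0∞) ≤ PI δ {ω | (fun v : Fin n => ω v) ∈
      {d : Fin n → ℕ | (∀ k < K, |emf d k - pm δ k| < ε) ∧
        (n : ℝ)⁻¹ * ∑ v, Real.log (pm δ (d v) / qc c (d v)) < h + ε ∧
        |(n : ℝ)⁻¹ * ∑ v, (d v : ℝ) - c| < ε}}) :
    Real.exp (-(n * (h + ε))) * (1 / 2) ≤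
      ∑ M ∈ Icc (N - r) (N + r), ∑ d ∈ piAntidiag univ M,
        ind {d : Fin n → ℕ | ∀ k < K, |emf d k - pm δ k| < ε} d * ∏ v, qc c (d v) := by
  classical
  have hn' : (0 : ℝ) < n := by exact_mod_cast hn
  set GS : Set (Fin n → ℕ) := {d : Fin n → ℕ | (∀ k < K, |emf d k - pm δ k| < ε) ∧
        (n : ℝ)⁻¹ * ∑ v, Real.log (pm δ (d v) / qc c (d v)) < h + ε ∧
        |(n : ℝ)⁻¹ * ∑ v, (d v : ℝ) - c| < ε} with hGS
  set W : Finset (Fin n → ℕ) := ((Icc (N - r) (N + r)).biUnion fun M => piAntidiag univ M).filter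
    (fun d => d ∈ GS) with hW
  have h1 : PI δ {ω | (fun v : Fin n => ω v) ∈ GS} ≤ PI δ {ω | (fun v : Fin n => ω v) ∈ W} := by
    apply measure_mono
    intro ω hω
    change (fun v : Fin n => ω v) ∈ W
    have hω' : (fun v : Fin n => ω v) ∈ GS := hω
    rw [hW, mem_filter]
    refine ⟨?_, hω'⟩
    rw [mem_biUnion]
    have := hr (∑ v : Fin n, ω v) (by
      have := hω'.2.2
      push_cast
      exact this)
    exact ⟨∑ v : Fin n, ω v, by rw [mem_Icc]; omega, by rw [mem_piAntidiag]; simp⟩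
  have h2 := (hp.trans h1).trans (cyl_union δ n W)
  have h3 : (1 / 2 : ℝ) ≤ ∑ d ∈ W, ∏ v, pm δ (d v) := by
    have e : (1 / 2 : ℝ≥0∞) = ENNReal.ofReal (1 / 2) := by
      rw [ENNReal.ofReal_div_of_pos (by norm_num)]; simp
    rw [e] at h2
    by_contra hlt
    push Not at hlt
    exact absurd h2 (not_le.2 ((ENNReal.ofReal_lt_ofReal_iff (by norm_num)).2 hlt))
  refine (mul_le_mul_of_nonneg_left h3 (Real.exp_pos _).le).trans ?_
  rw [← sum_biUnion]
  swap
  · intro M _ M' _ hne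
    change Disjoint (piAntidiag univ M) (piAntidiag univ M')
    rw [disjoint_left]
    intro d hd hd'
    rw [mem_piAntidiag] at hd hd'
    exact hne (hd.1.symm.trans hd'.1)
  rw [mul_sum]
  have hnn : ∀ d : Fin n → ℕ, 0 ≤ ind {d : Fin n → ℕ | ∀ k < K, |emf d k - pm δ k| < ε} d * ∏ v, qc c (d v) :=
    fun d => mul_nonneg (ind_nonneg _ _) (prod_nonneg fun _ _ => (qc_pos hc _).le)
  refine le_trans (sum_le_sum ?_) (sum_le_sum_of_subset_of_nonneg (filter_subset _ _) fun d _ _ => hnn d)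
  intro d hd
  rw [mem_filter] at hd
  have hd2 : d ∈ {d : Fin n → ℕ | ∀ k < K, |emf d k - pm δ k| < ε} := hd.2.1
  rw [ind, if_pos hd2, one_mul]
  apply prod_change hc
  have := hd.2.2.1
  rw [inv_mul_lt_iff₀ hn'] at this
  exact this.le

lemma lower_asym {c : ℝ} (hc : 0 < c) {lam : ℕ → ℕ}
    (hs : Tendsto (fun n : ℕ => ((2 * lam n : ℕ) : ℝ) / n) atTop (𝓝 c))
    (δ : ProbabilityMeasure ℕ) {h ε : ℝ} (hh0 : 0 ≤ h) (hε : 0 < ε) (K : ℕ)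
    (hmean : HasSum (fun k => pm δ k * (k : ℝ)) c)
    (hent : HasSum (fun k => pm δ k * Real.log (pm δ k / qc c k)) h)
    (hm : ∀ᶠ n in atTop, lam n ≤ (ND n).card) :
    ∀ᶠ n : ℕ in atTop, Real.exp (-(n * (h + 2 * ε))) ≤
      PP n (lam n) {d | ∀ k < K, |emf d k - pm δ k| < 5 * ε} := by
  set b : ℝ := (h + 2 * ε) / ε with hb
  have hb0 : 0 ≤ b := by positivity
  set θ : ℝ := Real.exp b with hθ
  have hθ1 : 1 ≤ θ := Real.one_le_exp hb0
  set s : ℕ → ℝ := fun n => ((2 * lam n : ℕ) : ℝ) / n with hsd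
  set C : ℝ := b + θ ^ 4 * ((1 + (c + 1)) * (c + 1) / 2) with hC
  have hG := good_prob (c := c) δ hε K hmean hent
  have hs1 : ∀ᶠ n in atTop, |s n - c| < ε := hs.eventually (Metric.ball_mem_nhds c hε)
  have hs2 : ∀ᶠ n : ℕ in atTop, s n < c + 1 := hs.eventually (gt_mem_nhds (by linarith))
  have ht : Tendsto (fun n : ℕ => (n : ℝ) * ε) atTop atTop :=
    tendsto_natCast_atTop_atTop.atTop_mul_const hε
  have h4 : ∀ᶠ n : ℕ in atTop, Real.exp (C - n * ε) ≤ 1 / 4 := by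
    have h5 : Tendsto (fun n : ℕ => Real.exp (C - n * ε)) atTop (𝓝 0) := by
      apply Real.tendsto_exp_atBot.comp
      simpa [sub_eq_add_neg] using tendsto_atBot_add_const_left atTop C (tendsto_neg_atTop_atBot.comp ht)
    filter_upwards [h5.eventually (gt_mem_nhds (by norm_num : (0 : ℝ) < 1 / 4))] with n hn
    exact hn.le
  have h5 : ∀ᶠ n : ℕ in atTop, Real.exp (-(n * ε)) ≤ 1 / 4 := by
    have h5 : Tendsto (fun n : ℕ => Real.exp (-(n * ε))) atTop (𝓝 0) :=
      Real.tendsto_exp_atBot.comp (tendsto_neg_atTop_atBot.comp ht)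
    filter_upwards [h5.eventually (gt_mem_nhds (by norm_num : (0 : ℝ) < 1 / 4))] with n hn
    exact hn.le
  filter_upwards [hG, hs1, hs2, h4, h5, hm, eventually_gt_atTop 0] with n hG hs1 hs2 h4 h5 hm hn
  have hn' : (0 : ℝ) < n := by exact_mod_cast hn
  have hN : ((2 * lam n : ℕ) : ℝ) = n * s n := by simp only [hsd]; field_simp
  have hs0 : 0 ≤ s n := by simp only [hsd]; positivity
  set r : ℕ := ⌊2 * ε * n⌋₊ with hr
  have hr1 : (r : ℝ) ≤ 2 * ε * n := Nat.floor_le (by positivity)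
  have hr2 : 2 * ε * n < r + 1 := Nat.lt_floor_add_one _
  have hrn : (r : ℝ) / n ≤ 2 * ε := by rw [div_le_iff₀ hn']; exact hr1
  have hg := good_sum hn hc δ (h := h) (ε := ε) K (r := r) (N := 2 * lam n) (by
    intro M hM
    have e1 : (n : ℝ)⁻¹ * M - c - (s n - c) = (n : ℝ)⁻¹ * (M - (2 * lam n : ℕ)) := by
      rw [hN]; field_simp; ring
    rw [abs_lt] at hM hs1
    have e2 : (M : ℝ) - (2 * lam n : ℕ) = n * ((n : ℝ)⁻¹ * M - c - (s n - c)) := by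
      rw [e1]; field_simp
    have e3 : (M : ℝ) - (2 * lam n : ℕ) < r + 1 := by
      rw [e2]; nlinarith
    have e4 : -((r : ℝ) + 1) < (M : ℝ) - (2 * lam n : ℕ) := by
      rw [e2]; nlinarith
    constructor
    · have : (M : ℝ) < ((2 * lam n + r + 1 : ℕ) : ℝ) := by push_cast at e3 ⊢; linarith
      have : M < 2 * lam n + r + 1 := by exact_mod_cast this
      omega
    · have : ((2 * lam n : ℕ) : ℝ) < ((M + r + 1 : ℕ) : ℝ) := by push_cast at e4 ⊢; linarith
      have : 2 * lam n < M + r + 1 := by exact_mod_cast this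
      omega) hG
  have hsh : ∀ x : ℝ, ∀ d e : Fin n → ℕ, d ∈ {d : Fin n → ℕ | ∀ k < K, |emf d k - pm δ k| < x} →
      rh d e ≤ r → e ∈ {d : Fin n → ℕ | ∀ k < K, |emf d k - pm δ k| < x + 2 * ε} := by
    intro x d e hd hde k hk
    have h1 := emf_rh hn d e k hde
    have h2 : |emf d k - pm δ k| < x := hd k hk
    have h3 : emf e k - pm δ k = (emf e k - emf d k) + (emf d k - pm δ k) := by ring
    rw [h3]
    refine (abs_add_le _ _).trans_lt ?_
    linarith
  have hT := TT_lower hn hc (r := r) (N := 2 * lam n) (hsh ε)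
  have hL := graph_lower hn (lam n) r hm hθ1 (hsh (ε + 2 * ε))
  have e5 : ε + 2 * ε + 2 * ε = 5 * ε := by ring
  rw [e5] at hL
  change _ ≤ PP n (lam n) {d | ∀ k < K, |emf d k - pm δ k| < 5 * ε} + _ at hL
  have hmain := (hg.trans hT).trans hL
  have htail : (θ ^ r)⁻¹ * (1 + θ ^ 4 * ((n + 2 * (lam n : ℝ)) / n ^ 2)) ^ (lam n) ≤
      Real.exp (-(n * (h + ε))) * Real.exp (C - n * ε) := by
    have t1 : (θ ^ r)⁻¹ ≤ Real.exp (b - n * (h + 2 * ε)) := by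
      rw [hθ, ← Real.exp_nat_mul, ← Real.exp_neg]
      apply Real.exp_le_exp.2
      have : n * (h + 2 * ε) = b * (ε * n) := by rw [hb]; field_simp
      rw [this]
      have : 0 ≤ ε * n := by positivity
      nlinarith
    have t2 : (1 + θ ^ 4 * ((n + 2 * (lam n : ℝ)) / n ^ 2)) ^ (lam n) ≤
        Real.exp (θ ^ 4 * ((1 + (c + 1)) * (c + 1) / 2)) := by
      have t3 := Real.add_one_le_exp (θ ^ 4 * ((n + 2 * (lam n : ℝ)) / n ^ 2))
      rw [add_comm] at t3
      refine (pow_le_pow_left₀ (by positivity) t3 _).trans ?_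
      rw [← Real.exp_nat_mul]
      apply Real.exp_le_exp.2
      have hl : (lam n : ℝ) = n * s n / 2 := by rw [← hN]; push_cast; ring
      have : (lam n : ℝ) * (θ ^ 4 * ((n + 2 * (lam n : ℝ)) / n ^ 2)) = θ ^ 4 * ((1 + s n) * s n / 2) := by
        rw [hl]; field_simp
      rw [this]
      gcongr
    calc _ ≤ Real.exp (b - n * (h + 2 * ε)) * Real.exp (θ ^ 4 * ((1 + (c + 1)) * (c + 1) / 2)) := by
          gcongr
      _ = _ := by
          rw [← Real.exp_add, ← Real.exp_add]
          congr 1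
          rw [hC]; ring
  have hX : 0 < Real.exp (-(n * (h + ε))) := Real.exp_pos _
  have e6 : Real.exp (-(n * (h + 2 * ε))) = Real.exp (-(n * (h + ε))) * Real.exp (-(n * ε)) := by
    rw [← Real.exp_add]; congr 1; ring
  rw [e6]
  nlinarith [mul_le_mul_of_nonneg_left h4 hX.le, mul_le_mul_of_nonneg_left h5 hX.le]


lemma rho_pos (d : ℕ) : 0 < rho d := by
  unfold rho
  have h1 : 0 < Real.Gamma (((d : ℝ) + 2) / 2) := Real.Gamma_pos_of_pos (by positivity)
  have h2 : 0 < Real.pi := Real.pi_pos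
  positivity

lemma PP_le_one (n m : ℕ) (S : Set (Fin n → ℕ)) : PP n m S ≤ 1 := by
  unfold PP
  have h : ∑ E ∈ erGraphs n m, ind S (degr E) ≤ (erGraphs n m).card := by
    have := sum_le_card_nsmul (erGraphs n m) (fun E => ind S (degr E)) 1 (fun E _ => ind_le_one _ _)
    simpa using this
  rcases Nat.eq_zero_or_pos (erGraphs n m).card with h0 | h0
  · simp [h0]
  · rw [inv_mul_le_iff₀ (by exact_mod_cast h0), mul_one]
    exact h

lemma uniform_eq {n m : ℕ} (hm : m ≤ (ND n).card) (A : Set (Finset (Sym2 (Fin n))))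
    (S : Set (Fin n → ℕ)) (h : ∀ E, E ∈ A ↔ degr E ∈ S) :
    uniformOn (erGraphs n m) A = ENNReal.ofReal (PP n m S) := by
  have hpos := er_card_pos n m hm
  have hpos' : (0 : ℝ) < (erGraphs n m).card := by exact_mod_cast hpos
  unfold uniformOn PP
  rw [ENNReal.ofReal_mul (by positivity), ENNReal.ofReal_inv_of_pos hpos', ENNReal.ofReal_natCast,
    ENNReal.ofReal_sum_of_nonneg (fun _ _ => ind_nonneg _ _), Measure.smul_apply,
    Measure.finsetSum_apply, smul_eq_mul]
  congr 1
  apply sum_congr rfl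
  intro E _
  rw [Measure.dirac_apply' _ (by trivial)]
  by_cases hE : E ∈ A
  · have := (h E).1 hE
    simp [ind, hE, this]
  · have : degr E ∉ S := fun h' => hE ((h E).2 h')
    simp [ind, hE, this]

lemma elog_exp (y : ℝ) : ENNReal.log (ENNReal.ofReal (Real.exp y)) = (y : EReal) := by
  rw [ENNReal.log_ofReal_of_pos (Real.exp_pos _), Real.log_exp]

lemma elog_mul {n : ℕ} (hn : 0 < n) (a : ℝ) :
    ((n : ℝ)⁻¹ : EReal) * ENNReal.log (ENNReal.ofReal (Real.exp (-(n * a)))) = ((-a : ℝ) : EReal) := by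
  have hn' : (n : ℝ) ≠ 0 := by exact_mod_cast hn.ne'
  rw [elog_exp]
  change (((n : ℝ)⁻¹ : ℝ) : EReal) * _ = _
  rw [← EReal.coe_mul]
  congr 1
  field_simp

lemma inv_n_nonneg (n : ℕ) : (0 : EReal) ≤ ((n : ℝ)⁻¹ : EReal) := by
  change (0 : EReal) ≤ (((n : ℝ)⁻¹ : ℝ) : EReal)
  exact_mod_cast (by positivity : (0 : ℝ) ≤ (n : ℝ)⁻¹)

lemma elog_le {n : ℕ} (hn : 0 < n) {a p : ℝ} (h : p ≤ Real.exp (-(n * a))) :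
    ((n : ℝ)⁻¹ : EReal) * ENNReal.log (ENNReal.ofReal p) ≤ ((-a : ℝ) : EReal) := by
  rw [← elog_mul hn]
  exact mul_le_mul_of_nonneg_left (ENNReal.log_monotone (ENNReal.ofReal_le_ofReal h)) (inv_n_nonneg n)

lemma le_elog {n : ℕ} (hn : 0 < n) {a p : ℝ} (h : Real.exp (-(n * a)) ≤ p) :
    ((-a : ℝ) : EReal) ≤ ((n : ℝ)⁻¹ : EReal) * ENNReal.log (ENNReal.ofReal p) := by
  rw [← elog_mul hn]
  exact mul_le_mul_of_nonneg_left (ENNReal.log_monotone (ENNReal.ofReal_le_ofReal h)) (inv_n_nonneg n)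

lemma hasSum_of_ofReal {f : ℕ → ℝ} (hf : ∀ k, 0 ≤ f k) {a : ℝ} (ha : 0 ≤ a)
    (h : ∑' k, ENNReal.ofReal (f k) = ENNReal.ofReal a) : HasSum f a := by
  have hne : ∑' k, ENNReal.ofReal (f k) ≠ ⊤ := by rw [h]; exact ENNReal.ofReal_ne_top
  have h1 := ENNReal.hasSum_toReal hne
  rw [← ENNReal.tsum_toReal_eq (fun k => ENNReal.ofReal_ne_top), h, ENNReal.toReal_ofReal ha] at h1
  simpa [ENNReal.toReal_ofReal, hf] using h1

lemma eta_sums {c : ℝ} (hc : 0 < c) {δ : ProbabilityMeasure ℕ} (h : etaRate c δ ≠ ⊤) :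
    HasSum (fun k => pm δ k * (k : ℝ)) c ∧
    HasSum (fun k => pm δ k * Real.log (pm δ k / qc c k)) (etaRate c δ).toReal := by
  have hm := (eta_le_iff h le_rfl).1
  have he : etaRate c δ = relEntN (δ : Measure ℕ) (poisMeasure c) := by
    unfold etaRate
    rw [if_pos hm]
  constructor
  · apply hasSum_of_ofReal (fun k => mul_nonneg (pm_nonneg _ _) (by positivity)) hc.le
    rw [← hm]
    apply tsum_congr
    intro k
    rw [ENNReal.ofReal_mul (pm_nonneg _ _), pm, ENNReal.ofReal_toReal (mass_ne_top _ _)]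
    simp [mul_comm]
  · have h1 : HasSum (fun k => hh (qc c k) (pm δ k)) (etaRate c δ).toReal := by
      apply hasSum_of_ofReal (fun k => hh_nonneg (qc_pos hc k) (pm_nonneg _ _)) ENNReal.toReal_nonneg
      rw [ENNReal.ofReal_toReal h, he, relEnt_eq hc]
      rfl
    have h2 : HasSum (pm δ) 1 := by
      apply hasSum_of_ofReal (fun k => pm_nonneg _ _) zero_le_one
      rw [ENNReal.ofReal_one, ← pm_tsum δ]
      apply tsum_congr
      intro k
      rw [pm, ENNReal.ofReal_toReal (mass_ne_top _ _)]
    have h3 := (h1.add h2).sub (qc_hasSum c)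
    have e : (fun k => hh (qc c k) (pm δ k) + pm δ k - qc c k)
      = fun k => pm δ k * Real.log (pm δ k / qc c k) := by ext k; unfold hh; ring
    rw [e] at h3
    simpa using h3

lemma ev_le_ND {c : ℝ} {lam : ℕ → ℕ}
    (hs : Tendsto (fun n : ℕ => ((2 * lam n : ℕ) : ℝ) / n) atTop (𝓝 c)) :
    ∀ᶠ n in atTop, lam n ≤ (ND n).card := by
  have h1 := hs.eventually (gt_mem_nhds (by linarith : c < c + 1))
  have h2 : ∀ᶠ n : ℕ in atTop, c + 2 ≤ (n : ℝ) := tendsto_natCast_atTop_atTop.eventually_ge_atTop _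
  filter_upwards [h1, h2, eventually_gt_atTop 0] with n h1 h2 hn
  have hn' : (0 : ℝ) < n := by exact_mod_cast hn
  rw [div_lt_iff₀ hn'] at h1
  push_cast at h1
  have h3 := card_ND n
  have : (lam n : ℝ) ≤ (ND n).card := by nlinarith
  exact_mod_cast this

lemma ldp_aux {c : ℝ} (hc : 0 < c) (lam : ℕ → ℕ)
    (hs : Tendsto (fun n : ℕ => ((2 * lam n : ℕ) : ℝ) / n) atTop (𝓝 c))
    (D : ∀ n : ℕ, Finset (Sym2 (Fin n)) → ProbabilityMeasure ℕ)
    (hD : ∀ n : ℕ, ∀ hn : 0 < n, ∀ E : Finset (Sym2 (Fin n)), D n E = tp hn (degr E)) :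
    IsLDP (fun n F => uniformOn (erGraphs n (lam n)) (D n ⁻¹' F)) (etaRate c) := by
  have hND := ev_le_ND hs
  have hev : ∀ F : Set (ProbabilityMeasure ℕ), ∀ᶠ n in atTop,
      uniformOn (erGraphs n (lam n)) (D n ⁻¹' F) =
        ENNReal.ofReal (PP n (lam n) {d | ∃ hn : 0 < n, tp hn d ∈ F}) := by
    intro F
    filter_upwards [hND, eventually_gt_atTop 0] with n h1 hn
    apply uniform_eq h1
    intro E
    rw [Set.mem_preimage, hD n hn E]
    exact ⟨fun h => ⟨hn, h⟩, fun ⟨_, h⟩ => h⟩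
  refine ⟨eta_good hc, ?_, ?_⟩
  · intro F hF
    by_contra hlt
    push Not at hlt
    obtain ⟨z, hz1, hz2⟩ := EReal.lt_iff_exists_real_btwn.1 hlt
    have hzI : ((-z : ℝ) : EReal) < ⨅ x ∈ F, (etaRate c x : EReal) := by
      rw [EReal.coe_neg]
      exact EReal.neg_lt_comm.1 hz1
    refine absurd hz2 (not_lt.2 ?_)
    have key : ∀ᶠ n : ℕ in atTop, PP n (lam n) {d | ∃ hn : 0 < n, tp hn d ∈ F} ≤
        Real.exp (-(n * (-z))) := by
      rcases lt_or_ge (-z) 0 with hneg | hpos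
      · refine Eventually.of_forall fun n => (PP_le_one _ _ _).trans ?_
        apply Real.one_le_exp
        have : (0 : ℝ) ≤ n := by positivity
        nlinarith
      · obtain ⟨a', ha1, ha2⟩ := EReal.lt_iff_exists_real_btwn.1 hzI
        have ha1' : -z < a' := by exact_mod_cast ha1
        have ha0 : 0 < a' := lt_of_le_of_lt hpos ha1'
        have hx : ∀ x ∈ F, ((a'.toNNReal : ℝ≥0) : ℝ≥0∞) < etaRate c x := by
          intro x hx
          have h1 : (a' : EReal) < (etaRate c x : EReal) := ha2.trans_le (iInf₂_le x hx)
          have h2 : (a' : EReal) = (((a'.toNNReal : ℝ≥0) : ℝ≥0∞) : EReal) := by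
            rw [EReal.coe_nnreal_eq_coe_real, Real.coe_toNNReal _ ha0.le]
          rw [h2] at h1
          exact_mod_cast h1
        have hent := ent_lower hc hF a'.toNNReal hx _ hs
        apply upper_asym hc hs ha1'
        filter_upwards [hent] with n hent
        rintro d ⟨hn, hd⟩ hsum
        have h3 := hent (tp hn d) hd (by rw [tp_mean, hsum])
        have h4 := GG_ge hn hc d h3 (by simpa using ha0)
        rwa [Real.coe_toNNReal _ ha0.le] at h4
    apply limsup_le_of_le
    · isBoundedDefault
    filter_upwards [key, hev F, eventually_gt_atTop 0] with n h1 h2 hn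
    rw [h2]
    have := elog_le hn h1
    simpa using this
  · intro O hO
    by_contra hlt
    push Not at hlt
    obtain ⟨z, hz1, hz2⟩ := EReal.lt_iff_exists_real_btwn.1 hlt
    have hzI : (⨅ x ∈ O, (etaRate c x : EReal)) < ((-z : ℝ) : EReal) := by
      rw [EReal.coe_neg]
      exact EReal.lt_neg_comm.1 hz2
    refine absurd hz1 (not_lt.2 ?_)
    simp only [iInf_lt_iff] at hzI
    obtain ⟨δ, hδO, hδ⟩ := hzI
    have hne : etaRate c δ ≠ ⊤ := by
      intro h
      rw [h] at hδ
      simp at hδ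
    set h : ℝ := (etaRate c δ).toReal with hh'
    have hδ' : h < -z := by
      rw [← EReal.coe_ennreal_toReal hne] at hδ
      exact_mod_cast hδ
    obtain ⟨K, ε, hε, hnb⟩ := nbhd_basic hO hδO
    obtain ⟨s1, s2⟩ := eta_sums hc hne
    set ε' : ℝ := min (ε / 5) ((-z - h) / 2) with hε'
    have hε'0 : 0 < ε' := lt_min (by linarith) (by linarith)
    have hl := lower_asym hc hs δ (h := h) ENNReal.toReal_nonneg hε'0 K s1 s2 hND
    have i1 : 5 * ε' ≤ ε := by have := min_le_left (ε / 5) ((-z - h) / 2); linarith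
    have i2 : h + 2 * ε' ≤ -z := by have := min_le_right (ε / 5) ((-z - h) / 2); linarith
    apply le_liminf_of_le
    · isBoundedDefault
    filter_upwards [hl, hev O, eventually_gt_atTop 0] with n h1 h2 hn
    rw [h2]
    have h3 : PP n (lam n) {d | ∀ k < K, |emf d k - pm δ k| < 5 * ε'} ≤
        PP n (lam n) {d | ∃ hn : 0 < n, tp hn d ∈ O} := by
      unfold PP
      apply mul_le_mul_of_nonneg_left _ (by positivity)
      apply sum_le_sum
      intro E _
      apply ind_le
      intro hE
      refine ⟨hn, hnb _ fun k hk => ?_⟩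
      rw [tp_mass]
      exact (hE k hk).trans_le i1
    have h4 := le_elog hn (h1.trans h3)
    refine le_trans ?_ h4
    rw [EReal.coe_le_coe_iff]
    linarith

theorem erdosRenyi_degree_LDP (d : ℕ) (hd : 1 ≤ d) (t : ℝ) (ht : 0 < t) (lam : ℕ → ℕ)
    (hlam : Tendsto (fun n : ℕ => (lam n : ℝ) / n) atTop (𝓝 (rho d * t / 2)))
    (D : ∀ n : ℕ, Finset (Sym2 (Fin n)) → ProbabilityMeasure ℕ)
    (hD : ∀ n : ℕ, 0 < n → ∀ E : Finset (Sym2 (Fin n)),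
      (D n E : Measure ℕ) = (n : ℝ≥0∞)⁻¹ • ∑ v : Fin n, Measure.dirac (degr E v)) :
    IsLDP (fun n F => uniformOn (erGraphs n (lam n)) (D n ⁻¹' F)) (etaRate (rho d * t)) := by
  apply ldp_aux (mul_pos (rho_pos d) ht) lam _ D
  · intro n hn E
    exact Subtype.ext (hD n hn E)
  · have := hlam.const_mul 2
    rw [show 2 * (rho d * t / 2) = rho d * t by ring] at this
    refine this.congr fun n => ?_
    push_cast
    ring
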